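/- arXiv:1406.7805 — 16 statements merged into one kernel-verified Lean document; each statement's English description precedes it below -/
import Mathlib

section
/- Let X be a regular T1 topological space such that every countable discrete subspace of X has compact closure in X, and suppose every open cover of X admits a subcover of cardinality strictly less than cov(M). Then every countable subset of X has compact closure in X. -/
open Set Topology Filter Cardinal

/-- `cov(M)`: the least cardinality of a family of meager subsets of `ℝ` whose union is `ℝ`. -/
noncomputable def covMeager : Cardinal :=
  sInf {c : Cardinal | ∃ S : Set (Set ℝ),
    (∀ s ∈ S, IsMeagre s) ∧ ⋃₀ S = Set.univ ∧ #(↥S) = c}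

/-- Fewer than `cov(M)` meager sets do not cover the real line. -/
lemma exists_forall_notMem_of_lt_covMeager {ι : Type} (hι : #ι < covMeager) (M : ι → Set ℝ)
    (hM : ∀ i, IsMeagre (M i)) : ∃ x, ∀ i, x ∉ M i := by
  by_contra! h
  have hle : covMeager ≤ #(range M) := by
    refine csInf_le' ⟨range M, ?_, ?_, rfl⟩
    · rintro _ ⟨i, rfl⟩
      exact hM i
    · refine eq_univ_of_forall fun x => ?_
      obtain ⟨i, hi⟩ := h x
      exact ⟨M i, mem_range_self i, hi⟩
  exact absurd (hle.trans mk_range_le) (not_le.2 hι)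

/-- Inside a nonempty open set of reals, beyond some index the binary digits can be prescribed to be
a block of zeros followed by a one. -/
lemma exists_open_subset_odd_floor {J : Set ℝ} (hJ : IsOpen J) (hne : J.Nonempty) :
    ∃ k : ℕ, ∀ m > k, ∃ J' ⊆ J, IsOpen J' ∧ J'.Nonempty ∧
      ∀ x ∈ J', Odd ⌊(2 : ℝ) ^ m * x⌋ ∧ ∀ i, k < i → i < m → ¬ Odd ⌊(2 : ℝ) ^ i * x⌋ := by
  obtain ⟨y, hy⟩ := hne
  obtain ⟨ε, hε, hball⟩ := Metric.isOpen_iff.1 hJ y hy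
  obtain ⟨k, hk⟩ := exists_pow_lt_of_lt_one hε (by norm_num : (1 / 2 : ℝ) < 1)
  have h2k : (0 : ℝ) < 2 ^ k := by positivity
  set j : ℤ := ⌊(2 : ℝ) ^ k * y⌋ with hj
  have hj1 : (j : ℝ) ≤ 2 ^ k * y := Int.floor_le _
  have hj2 : 2 ^ k * y < j + 1 := Int.lt_floor_add_one _
  have hkε : 1 < 2 ^ k * ε := by
    rw [one_div, inv_pow] at hk
    exact (inv_lt_iff_one_lt_mul₀' h2k).1 hk
  refine ⟨k, fun m hm => ?_⟩
  obtain ⟨d, rfl⟩ : ∃ d, m = k + (d + 1) := ⟨m - k - 1, by omega⟩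
  have h2m : (0 : ℝ) < 2 ^ (k + (d + 1)) := by positivity
  have hd : (1 : ℝ) ≤ 2 ^ d := one_le_pow₀ (by norm_num)
  set g : ℝ → ℝ := fun x => 2 ^ (k + (d + 1)) * x with hg
  have hgc : Continuous g := by fun_prop
  refine ⟨g ⁻¹' Ioo ((j : ℝ) * 2 ^ (d + 1) + 1) (j * 2 ^ (d + 1) + 2), ?_,
    isOpen_Ioo.preimage hgc, ⟨((j : ℝ) * 2 ^ (d + 1) + 3 / 2) / 2 ^ (k + (d + 1)), ?_⟩, ?_⟩
  · rintro x ⟨hx1, hx2⟩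
    apply hball
    simp only [hg, pow_add, pow_one] at hx1 hx2
    have hlo : (j : ℝ) < 2 ^ k * x := by
      by_contra! hcon
      nlinarith
    have hhi : 2 ^ k * x < j + 1 := by
      by_contra! hcon
      nlinarith
    rw [Metric.mem_ball, Real.dist_eq, abs_lt]
    constructor <;> nlinarith
  · simp only [hg, mem_preimage, mul_div_cancel₀ _ h2m.ne']
    constructor <;> linarith
  · rintro x ⟨hx1, hx2⟩
    simp only [hg] at hx1 hx2
    refine ⟨?_, fun i hki him => ?_⟩
    · have : ⌊(2 : ℝ) ^ (k + (d + 1)) * x⌋ = 2 * (j * 2 ^ d) + 1 := by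
        rw [Int.floor_eq_iff]
        push_cast
        rw [pow_succ 2 d] at hx1 hx2
        constructor <;> linarith
      exact ⟨_, this⟩
    · obtain ⟨p, rfl⟩ : ∃ p, i = k + (p + 1) := ⟨i - k - 1, by omega⟩
      obtain ⟨q, rfl⟩ : ∃ q, d = p + (q + 1) := ⟨d - p - 1, by omega⟩
      have hq : (1 : ℝ) ≤ 2 ^ q := one_le_pow₀ (by norm_num)
      have : ⌊(2 : ℝ) ^ (k + (p + 1)) * x⌋ = 2 * (j * 2 ^ p) := by
        rw [Int.floor_eq_iff]
        push_cast
        have e1 : (2 : ℝ) ^ (k + (p + (q + 1) + 1)) * x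
            = (2 ^ (k + (p + 1)) * x) * (2 * 2 ^ q) := by ring
        have e2 : (j : ℝ) * 2 ^ (p + (q + 1) + 1) = (2 * (j * 2 ^ p)) * (2 * 2 ^ q) := by ring
        rw [e1, e2] at hx1 hx2
        generalize (2 : ℝ) ^ (k + (p + 1)) * x = u at *
        generalize (2 : ℝ) * (j * 2 ^ p) = v at *
        constructor
        · by_contra! hcon
          nlinarith
        · by_contra! hcon
          nlinarith
      rw [this, Int.not_odd_iff_even]
      exact even_two_mul _

/-- The points `e n` that are selected by the binary digits of `x` and avoid the sets `W (e i)` of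
all the previously selected points. -/
def digitSelection {X : Type*} (e : ℕ → X) (W : X → Set X) (x : ℝ) : Set X :=
  {a | ∃ n, e n = a ∧ Odd ⌊(2 : ℝ) ^ n * x⌋ ∧ ∀ i < n, Odd ⌊(2 : ℝ) ^ i * x⌋ → e n ∉ W (e i)}

lemma digitSelection_subset_range {X : Type*} (e : ℕ → X) (W : X → Set X) (x : ℝ) :
    digitSelection e W x ⊆ range e := by
  rintro _ ⟨n, rfl, -⟩
  exact mem_range_self n

lemma discreteTopology_digitSelection {X : Type*} [TopologicalSpace X] [T1Space X] (e : ℕ → X)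
    {W : X → Set X} (hWo : ∀ a, IsOpen (W a)) (hW : ∀ a, a ∈ W a) (x : ℝ) :
    DiscreteTopology (digitSelection e W x) := by
  rw [discreteTopology_subtype_iff']
  rintro _ ⟨n, rfl, hn, hn'⟩
  have hfin : (e '' Iio n \ {e n}).Finite := ((finite_Iio n).image e).subset sdiff_subset
  refine ⟨W (e n) \ (e '' Iio n \ {e n}), (hWo _).sdiff hfin.isClosed, ?_⟩
  refine Subset.antisymm ?_ ?_
  · rintro _ ⟨⟨hmW, hm⟩, m, rfl, hmo, hm'⟩
    by_contra hne
    rcases lt_trichotomy m n with h | rfl | h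
    · exact hm ⟨⟨m, h, rfl⟩, hne⟩
    · exact hne rfl
    · exact hm' n h hn hmW
  · rintro _ rfl
    exact ⟨⟨hW _, fun h => h.2 rfl⟩, n, rfl, hn, hn'⟩

lemma isNowhereDense_digitSelection_subset {X : Type*} (e : ℕ → X) {W : X → Set X}
    (hW : ∀ a, a ∈ W a) {U : Set X} (hU : ∀ k, ¬ range e ⊆ U ∪ ⋃ i ∈ Iic k, W (e i)) :
    IsNowhereDense {x : ℝ | digitSelection e W x ⊆ U} := by
  rw [IsNowhereDense, ← not_nonempty_iff_eq_empty]
  intro hne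
  obtain ⟨k, hk⟩ := exists_open_subset_odd_floor isOpen_interior hne
  obtain ⟨_, ⟨m, rfl⟩, hm⟩ := not_subset.1 (hU k)
  simp only [mem_union, mem_iUnion, mem_Iic, exists_prop, not_or, not_exists, not_and] at hm
  have hkm : k < m := by
    by_contra! h
    exact hm.2 m h (hW _)
  obtain ⟨J, hJs, hJo, ⟨y, hy⟩, hJ⟩ := hk m hkm
  obtain ⟨x, hxJ, hx⟩ := mem_closure_iff.1 (interior_subset (hJs hy)) J hJo hy
  refine hm.1 (hx ⟨m, rfl, (hJ x hxJ).1, fun i him hi => ?_⟩)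
  by_cases hik : i ≤ k
  · exact hm.2 i hik
  · exact absurd hi ((hJ x hxJ).2 i (not_le.1 hik) him)

/-- A regular T1 space that is ωD-bounded and has Lindelöf degree `< cov(M)` is ω-bounded. -/
theorem stmt0 {X : Type} [TopologicalSpace X] [T1Space X] [RegularSpace X]
    (hωD : ∀ D : Set X, D.Countable → DiscreteTopology D → IsCompact (closure D))
    (hLind : ∀ 𝒰 : Set (Set X), (∀ U ∈ 𝒰, IsOpen U) → ⋃₀ 𝒰 = Set.univ →
      ∃ 𝒱 ⊆ 𝒰, #(↥𝒱) < covMeager ∧ ⋃₀ 𝒱 = Set.univ) :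
    ∀ A : Set X, A.Countable → IsCompact (closure A) := by
  intro A hA
  rcases A.eq_empty_or_nonempty with rfl | hne
  · simp
  obtain ⟨e, rfl⟩ := hA.exists_eq_range hne
  by_contra hcomp
  rw [isCompact_iff_ultrafilter_le_nhds] at hcomp
  push Not at hcomp
  obtain ⟨F, hF, hFlim⟩ := hcomp
  rw [le_principal_iff] at hF
  -- The sets whose trace on `range e` has closure outside `F` form a proper ideal.
  let Small : Set X → Prop := fun S => closure (S ∩ range e) ∉ F
  have small_union {S T : Set X} (hS : Small S) (hT : Small T) : Small (S ∪ T) := by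
    simp only [Small, union_inter_distrib_right, closure_union]
    exact fun h => (Ultrafilter.union_mem_iff.1 h).elim hS hT
  have small_biUnion {ι : Type} {t : Set ι} (ht : t.Finite) {S : ι → Set X}
      (hS : ∀ i ∈ t, Small (S i)) : Small (⋃ i ∈ t, S i) := by
    induction t, ht using Set.Finite.induction_on with
    | empty => simp [Small]
    | insert _ _ ih =>
      rw [biUnion_insert]
      exact small_union (hS _ (mem_insert _ _)) (ih fun i hi => hS i (mem_insert_of_mem _ hi))
  have not_subset_small {S : Set X} (hS : Small S) : ¬ range e ⊆ S := fun h =>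
    hS (by rwa [inter_eq_self_of_subset_right h])
  have hcov (x : X) : ∃ U, IsOpen U ∧ x ∈ U ∧ Small U := by
    by_cases hx : x ∈ closure (range e)
    · obtain ⟨V, hV, hVF⟩ := Filter.not_le.1 (hFlim x hx)
      obtain ⟨C, hC, hCc, hCV⟩ := exists_mem_nhds_isClosed_subset hV
      refine ⟨interior C, isOpen_interior, mem_interior_iff_mem_nhds.2 hC, fun h => hVF ?_⟩
      refine mem_of_superset h (Subset.trans ?_ hCV)
      exact closure_minimal (inter_subset_left.trans interior_subset) hCc
    · refine ⟨(closure (range e))ᶜ, isClosed_closure.isOpen_compl, hx, ?_⟩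
      have : (closure (range e))ᶜ ∩ range e = ∅ :=
        eq_empty_of_forall_notMem fun y hy => hy.1 (subset_closure hy.2)
      simp [Small, this]
  choose W hWo hW hWs using hcov
  obtain ⟨𝒱, h𝒱, hcard, h𝒱cov⟩ := hLind {U | IsOpen U ∧ Small U} (fun U hU => hU.1)
    (eq_univ_of_forall fun x => ⟨W x, ⟨hWo x, hWs x⟩, hW x⟩)
  have hinf : Infinite 𝒱 := by
    by_contra hfin
    rw [Set.infinite_coe_iff, Set.not_infinite] at hfin
    refine not_subset_small (small_biUnion hfin (S := id) fun U hU => (h𝒱 hU).2) ?_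
    simp only [id, ← sUnion_eq_biUnion, h𝒱cov, subset_univ]
  have small_finset (t : Finset 𝒱) : Small (⋃ U ∈ t, (U : Set X)) :=
    small_biUnion t.finite_toSet fun U _ => (h𝒱 U.2).2
  obtain ⟨x, hx⟩ := exists_forall_notMem_of_lt_covMeager (ι := Finset 𝒱)
    (by rwa [mk_finset_of_infinite])
    (fun t => {x : ℝ | digitSelection e W x ⊆ ⋃ U ∈ t, (U : Set X)})
    (fun t => (isNowhereDense_digitSelection_subset e hW fun k => not_subset_small
      (small_union (small_finset t) (small_biUnion (finite_Iic k) fun i _ => hWs _))).isMeagre)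
  have hD := hωD _ ((countable_range e).mono (digitSelection_subset_range e W x))
    (discreteTopology_digitSelection e hWo hW x)
  obtain ⟨t, ht⟩ := hD.elim_finite_subcover (fun U : 𝒱 => (U : Set X)) (fun U => (h𝒱 U.2).1)
    (by rw [← sUnion_eq_iUnion, h𝒱cov]; exact subset_univ _)
  exact hx t (subset_closure.trans ht)
end

section
/- Let X be a separable regular T1 space with a countable dense subset, and suppose X admits an open cover U with |U| < cov(M) such that for every finite subfamily V of U the closure of the union of V is not all of X. Then X has a countable discrete subspace whose closure in X is not compact (i.e., X is not ωD-bounded). -/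
open Set Topology Filter Cardinal

/-- The points of the sequence `s` selected before stage `n`: the point `s n` is selected when
`β n` holds and `s n` is not in the closure of the union of the sets `W x`, for `x` selected
earlier. -/
def greedySelection {X : Type*} [TopologicalSpace X] (s : ℕ → X) (W : X → Set X) (β : ℕ → Prop) :
    ℕ → Set X
  | 0 => ∅
  | n + 1 => greedySelection s W β n ∪
      {x | x = s n ∧ β n ∧ s n ∉ closure (⋃ y ∈ greedySelection s W β n, W y)}

section GreedySelection

variable {X : Type*} [TopologicalSpace X] (s : ℕ → X) (W : X → Set X) (β : ℕ → Prop)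

theorem greedySelection_finite (n : ℕ) : (greedySelection s W β n).Finite := by
  induction n with
  | zero => exact Set.finite_empty
  | succ n ih => exact ih.union ((Set.finite_singleton (s n)).subset fun x hx => hx.1)

theorem greedySelection_mono : Monotone (greedySelection s W β) :=
  monotone_nat_of_le_succ fun _ => Set.subset_union_left

variable {β} in
theorem greedySelection_congr {γ : ℕ → Prop} {n : ℕ} (h : ∀ i < n, (β i ↔ γ i)) :
    greedySelection s W β n = greedySelection s W γ n := by
  induction n with
  | zero => rfl
  | succ n ih =>
    simp only [greedySelection, ih fun i hi => h i (by omega), h n (by omega)]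

variable {β} in
theorem greedySelection_eq_of_forall_not {n m : ℕ} (hnm : n ≤ m)
    (h : ∀ i, n ≤ i → i < m → ¬ β i) :
    greedySelection s W β m = greedySelection s W β n := by
  induction m, hnm using Nat.le_induction with
  | base => rfl
  | succ m hm ih =>
    rw [← ih fun i hi hi' => h i hi (by omega)]
    simp [greedySelection, h m hm (by omega)]

variable {s W β} in
theorem notMem_of_mem_greedySelection {x y : X} {k m : ℕ} (hx : x ∈ greedySelection s W β k)
    (hy : y ∈ greedySelection s W β m) : y ∈ greedySelection s W β k ∨ y ∉ W x := by
  induction m with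
  | zero => exact hy.elim
  | succ m ih =>
    rcases hy with hy | ⟨rfl, hβ, hy⟩
    · exact ih hy
    · rcases lt_or_ge m k with hmk | hkm
      · exact Or.inl (greedySelection_mono s W β (Nat.succ_le_of_lt hmk) (Or.inr ⟨rfl, hβ, hy⟩))
      · exact Or.inr fun h => hy (subset_closure
          (mem_biUnion (greedySelection_mono s W β hkm hx) h))

theorem discreteTopology_iUnion_greedySelection [T1Space X] (hW : ∀ x, IsOpen (W x))
    (hxW : ∀ x, x ∈ W x) : DiscreteTopology (⋃ n, greedySelection s W β n : Set X) := by
  rw [discreteTopology_subtype_iff']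
  intro x hx
  obtain ⟨k, hk⟩ := mem_iUnion.1 hx
  refine ⟨W x \ (greedySelection s W β k \ {x}),
    (hW x).sdiff (((greedySelection_finite s W β k).subset sdiff_subset).isClosed), ?_⟩
  ext y
  constructor
  · rintro ⟨⟨hyW, hy⟩, hyD⟩
    obtain ⟨m, hm⟩ := mem_iUnion.1 hyD
    rcases notMem_of_mem_greedySelection hk hm with h | h
    · by_contra hne
      exact hy ⟨h, hne⟩
    · exact absurd hyW h
  · rintro rfl
    exact ⟨⟨hxW _, fun h => h.2 rfl⟩, hx⟩

end GreedySelection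

theorem floor_two_pow_mul_eq_div {i m : ℕ} (him : i ≤ m) (r : ℝ) :
    ⌊(2 : ℝ) ^ i * r⌋ = ⌊(2 : ℝ) ^ m * r⌋ / 2 ^ (m - i) := by
  have h := Int.floor_div_natCast ((2 : ℝ) ^ m * r) (2 ^ (m - i))
  push_cast at h
  rw [← h]
  congr 1
  obtain ⟨d, rfl⟩ := Nat.exists_eq_add_of_le him
  rw [Nat.add_sub_cancel_left, pow_add]
  field_simp

/-- In every nonempty open set of reals, some initial block of binary digits can be continued by an
arbitrarily long block of zeros followed by a one, throughout a nonempty open subset. -/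
theorem exists_digits_eq_of_isOpen {I : Set ℝ} (hI : IsOpen I) (hne : I.Nonempty) :
    ∃ (n : ℕ) (γ : ℕ → Prop), ∀ m > n, ∃ J ⊆ I, IsOpen J ∧ J.Nonempty ∧ ∀ r ∈ J,
      (∀ i ≤ n, (Odd ⌊(2 : ℝ) ^ i * r⌋ ↔ γ i)) ∧
      (∀ i, n < i → i < m → ¬ Odd ⌊(2 : ℝ) ^ i * r⌋) ∧ Odd ⌊(2 : ℝ) ^ m * r⌋ := by
  obtain ⟨r₀, hr₀⟩ := hne
  obtain ⟨ε, hε, hball⟩ := Metric.isOpen_iff.1 hI r₀ hr₀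
  obtain ⟨n, hn⟩ := exists_pow_lt_of_lt_one hε (by norm_num : (1 / 2 : ℝ) < 1)
  have hn' : 1 < ε * 2 ^ n := by
    rw [one_div, inv_pow, inv_lt_iff_one_lt_mul₀ (by positivity)] at hn
    linarith
  set k : ℤ := ⌊(2 : ℝ) ^ n * r₀⌋ with hk
  refine ⟨n, fun i => Odd (k / 2 ^ (n - i)), fun m hm => ?_⟩
  obtain ⟨d, rfl⟩ := Nat.exists_eq_add_of_lt hm
  set k' : ℤ := k * 2 ^ (d + 1) + 1 with hk'
  have hkey : ∀ r : ℝ, ⌊(2 : ℝ) ^ (n + d + 1) * r⌋ = k' → ∀ j ≤ n + d,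
      ⌊(2 : ℝ) ^ j * r⌋ = k * 2 ^ (d + 1) / 2 ^ (n + d + 1 - j) := by
    intro r hr j hj
    rw [floor_two_pow_mul_eq_div (by omega : j ≤ n + d + 1), hr, hk']
    obtain ⟨c, hc⟩ : ∃ c, n + d + 1 - j = c + 1 := ⟨n + d - j, by omega⟩
    rw [hc, pow_succ' 2 c, ← Int.ediv_ediv_of_nonneg (by norm_num),
      ← Int.ediv_ediv_of_nonneg (by norm_num)]
    congr 1
    rw [pow_succ, ← mul_assoc]
    omega
  refine ⟨(fun r : ℝ => 2 ^ (n + d + 1) * r) ⁻¹' Ioo (k' : ℝ) (k' + 1), ?_,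
    isOpen_Ioo.preimage (by fun_prop), ?_, ?_⟩
  · rintro r ⟨h1, h2⟩
    have hr : ⌊(2 : ℝ) ^ (n + d + 1) * r⌋ = k' := Int.floor_eq_iff.2 ⟨h1.le, h2⟩
    have hrn : ⌊(2 : ℝ) ^ n * r⌋ = k := by
      rw [hkey r hr n (by omega), show n + d + 1 - n = d + 1 by omega]
      exact Int.mul_ediv_cancel _ (by positivity)
    apply hball
    have h := Int.abs_sub_lt_one_of_floor_eq_floor (hrn.trans hk)
    rw [← mul_sub, abs_mul, abs_of_pos (by positivity)] at h
    rw [Metric.mem_ball, Real.dist_eq]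
    have hp : (0 : ℝ) < 2 ^ n := by positivity
    nlinarith
  · refine ⟨(k' + 1 / 2) / 2 ^ (n + d + 1), ?_⟩
    rw [mem_preimage, mul_div_cancel₀ _ (by positivity)]
    constructor <;> linarith
  · rintro r ⟨h1, h2⟩
    have hr : ⌊(2 : ℝ) ^ (n + d + 1) * r⌋ = k' := Int.floor_eq_iff.2 ⟨h1.le, h2⟩
    refine ⟨fun i hi => ?_, fun i hi him => ?_, ?_⟩
    · rw [hkey r hr i (by omega), show n + d + 1 - i = (d + 1) + (n - i) by omega,
        pow_add _ (d + 1) (n - i),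
        ← Int.ediv_ediv_of_nonneg (by positivity), Int.mul_ediv_cancel _ (by positivity)]
    · obtain ⟨c, rfl⟩ := Nat.exists_eq_add_of_lt hi
      rw [hkey r hr _ (by omega),
        show d + 1 = (c + 1) + (n + d + 1 - (n + c + 1)) by omega, pow_add, ← mul_assoc,
        Int.mul_ediv_cancel _ (by positivity), Int.not_odd_iff_even, pow_succ, ← mul_assoc]
      exact even_two.mul_left _
    · rw [hr, hk', pow_succ, ← mul_assoc]
      exact (even_two.mul_left _).add_one

/-- If for every finite `F` some term outside both `G` and the closure of the union of the `W y`,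
for `y ∈ F`, recurs infinitely often in `s`, then for generic `r` the points selected along the
binary digits of `r` are not all in `G`. -/
theorem isNowhereDense_setOf_greedySelection_subset {X : Type*} [TopologicalSpace X] (s : ℕ → X)
    (W : X → Set X) (G : Set X)
    (hG : ∀ F : Set X, F.Finite → ∃ n, ∀ k, ∃ m > k, s m = s n ∧
      s n ∉ closure (⋃ y ∈ F, W y) ∧ s n ∉ G) :
    IsNowhereDense
      {r : ℝ | ⋃ n, greedySelection s W (fun i => Odd ⌊(2 : ℝ) ^ i * r⌋) n ⊆ G} := by
  rw [IsNowhereDense]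
  by_contra hne
  obtain ⟨n, γ, h⟩ := exists_digits_eq_of_isOpen isOpen_interior
    (Set.nonempty_iff_ne_empty.2 hne)
  obtain ⟨l, hl⟩ := hG _ (greedySelection_finite s W γ (n + 1))
  obtain ⟨m, hm, hml, hcl, hlG⟩ := hl n
  obtain ⟨J, hJ, hJo, hJne, hJd⟩ := h m hm
  obtain ⟨r₀, hr₀⟩ := hJne
  obtain ⟨r, hrJ, hr⟩ := mem_closure_iff.1 (interior_subset (hJ hr₀)) J hJo hr₀
  obtain ⟨h1, h2, h3⟩ := hJd r hrJ
  refine hlG (hr (mem_iUnion.2 ⟨m + 1, Or.inr ⟨hml.symm, h3, ?_⟩⟩))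
  rw [greedySelection_eq_of_forall_not s W (n := n + 1) hm fun i hi => h2 i hi,
    greedySelection_congr s W (γ := γ) fun i hi => h1 i (by omega), hml]
  exact hcl

/-- A separable regular T1 space with an open cover of size `< cov(M)` such that no finite
subfamily has dense union is not ωD-bounded. -/
theorem stmt1 {X : Type} [TopologicalSpace X] [T1Space X] [RegularSpace X]
    (S : Set X) (hScount : S.Countable) (hSdense : Dense S)
    (𝒰 : Set (Set X)) (hopen : ∀ U ∈ 𝒰, IsOpen U) (hcov : ⋃₀ 𝒰 = Set.univ)
    (hcard : #(↥𝒰) < covMeager)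
    (hnofin : ∀ 𝒱 : Finset (Set X), ↑𝒱 ⊆ 𝒰 → closure (⋃₀ (𝒱 : Set (Set X))) ≠ Set.univ) :
    ∃ D : Set X, D.Countable ∧ DiscreteTopology D ∧ ¬ IsCompact (closure D) := by
  classical
  have hfin : ∀ 𝒱 ⊆ 𝒰, 𝒱.Finite → ∃ x ∈ S, x ∉ closure (⋃₀ 𝒱) := by
    intro 𝒱 hsub h
    have h' := hnofin h.toFinset (by simpa using hsub)
    rw [h.coe_toFinset, ← nonempty_compl] at h'
    obtain ⟨x, hx, hxS⟩ := hSdense.inter_open_nonempty _ isClosed_closure.isOpen_compl h'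
    exact ⟨x, hxS, hx⟩
  obtain ⟨x₀, hx₀, -⟩ := hfin ∅ (empty_subset _) finite_empty
  obtain ⟨e, rfl⟩ := hScount.exists_eq_range ⟨x₀, hx₀⟩
  have hmem : ∀ x, ∃ U ∈ 𝒰, x ∈ U := fun x => by
    rw [← mem_sUnion, hcov]
    trivial
  choose W hWU hxW using hmem
  set s : ℕ → X := fun n => e n.unpair.1 with hs
  set D : ℝ → Set X := fun r => ⋃ n, greedySelection s W (fun i => Odd ⌊(2 : ℝ) ^ i * r⌋) n
  by_contra! hcon
  have hDcomp : ∀ r, IsCompact (closure (D r)) := fun r =>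
    hcon _ (countable_iUnion fun n => (greedySelection_finite s W _ n).countable)
      (discreteTopology_iUnion_greedySelection s W _ (fun x => hopen _ (hWU x)) hxW)
  have hinf : Infinite 𝒰 := by
    by_contra h
    rw [not_infinite_iff_finite] at h
    obtain ⟨x, -, hx⟩ := hfin 𝒰 Subset.rfl h
    exact hx (by simp [hcov])
  let N : Finset 𝒰 → Set ℝ := fun 𝒱 => {r | D r ⊆ ⋃ U ∈ 𝒱, (U : Set X)}
  refine hcard.not_ge ?_
  have hN : covMeager ≤ #(range N) := by
    rw [covMeager]
    refine csInf_le' ⟨range N, ?_, ?_, rfl⟩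
    · rintro _ ⟨𝒱, rfl⟩
      refine (isNowhereDense_setOf_greedySelection_subset s W _ fun F hF => ?_).isMeagre
      obtain ⟨_, ⟨a, rfl⟩, hx⟩ := hfin (W '' F ∪ (↑) '' (𝒱 : Set 𝒰)) (by
        rintro _ (⟨x, -, rfl⟩ | ⟨U, -, rfl⟩)
        exacts [hWU x, U.2]) ((hF.image W).union (𝒱.finite_toSet.image _))
      rw [sUnion_union, sUnion_image, sUnion_image, closure_union] at hx
      refine ⟨Nat.pair a 0, fun k => ⟨Nat.pair a (k + 1), Nat.right_le_pair a (k + 1), ?_⟩⟩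
      simp only [hs, Nat.unpair_pair, true_and]
      exact ⟨fun h => hx (Or.inl h), fun h => hx (Or.inr (subset_closure h))⟩
    · refine eq_univ_of_forall fun r => ?_
      obtain ⟨t, ht⟩ := (hDcomp r).elim_finite_subcover (fun U : 𝒰 => (U : Set X))
        (fun U => hopen U U.2) (by rw [← sUnion_eq_iUnion, hcov]; exact subset_univ _)
      exact ⟨N t, mem_range_self t, subset_closure.trans ht⟩
  calc covMeager ≤ #(range N) := hN
    _ ≤ #(Finset 𝒰) := mk_range_le
    _ = #𝒰 := mk_finset_of_infinite _
end

section
/- Let X be a regular, countably compact T1 space, let S ⊆ X be dense in X, and let A ⊆ X be a countable nowhere dense subset such that X has countable tightness at every point of A. Then there exists a countable discrete subset D of S such that A is contained in the closure of D in X. -/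
open Set Topology Filter

/-- A space is countably compact iff every countable open cover has a finite subcover. -/
def CountablyCompactSp (X : Type*) [TopologicalSpace X] : Prop :=
  ∀ 𝒰 : Set (Set X), 𝒰.Countable → (∀ U ∈ 𝒰, IsOpen U) → ⋃₀ 𝒰 = Set.univ →
    ∃ 𝒱 ⊆ 𝒰, 𝒱.Finite ∧ ⋃₀ 𝒱 = Set.univ

/-- `X` has countable tightness at `x`. -/
def CountableTightnessAt {X : Type*} [TopologicalSpace X] (x : X) : Prop :=
  ∀ A : Set X, x ∈ closure A → ∃ B ⊆ A, B.Countable ∧ x ∈ closure B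

/-- In a countably compact space, a decreasing sequence of nonempty closed sets has a common
point. -/
lemma CountablyCompactSp.nonempty_iInter {X : Type*} [TopologicalSpace X]
    (hcc : CountablyCompactSp X) (C : ℕ → Set X) (hC : ∀ n, IsClosed (C n))
    (hanti : Antitone C) (hne : ∀ n, (C n).Nonempty) : (⋂ n, C n).Nonempty := by
  by_contra hempty
  rw [not_nonempty_iff_eq_empty] at hempty
  obtain ⟨𝒱, h𝒱, hfin, hcov⟩ := hcc (range fun n => (C n)ᶜ) (countable_range _)
    (by rintro _ ⟨n, rfl⟩; exact (hC n).isOpen_compl)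
    (by rw [sUnion_range, ← compl_iInter, hempty, compl_empty])
  choose! g hg using h𝒱
  obtain ⟨N, hN⟩ := (hfin.image g).bddAbove
  obtain ⟨x, hx⟩ := hne N
  obtain ⟨V, hV, hxV⟩ : x ∈ ⋃₀ 𝒱 := hcov ▸ mem_univ x
  rw [← hg hV] at hxV
  exact hxV (hanti (hN ⟨V, hV, rfl⟩) hx)

/-- In a countably compact space, every sequence has a cluster point. -/
lemma CountablyCompactSp.exists_mem_closure_tails {X : Type*} [TopologicalSpace X]
    (hcc : CountablyCompactSp X) (d : ℕ → X) : ∃ z, ∀ n, z ∈ closure (d '' Ici n) := by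
  obtain ⟨z, hz⟩ := hcc.nonempty_iInter (fun n => closure (d '' Ici n))
    (fun _ => isClosed_closure)
    (fun _ _ h => closure_mono (image_mono (Ici_subset_Ici.2 h)))
    (fun n => ⟨d n, subset_closure ⟨n, self_mem_Ici, rfl⟩⟩)
  exact ⟨z, fun n => mem_iInter.1 hz n⟩

/-- A set whose points have neighbourhoods meeting it in finite sets is discrete. -/
lemma discreteTopology_of_locally_finite {X : Type*} [TopologicalSpace X] [T1Space X] (D : Set X)
    (h : ∀ d ∈ D, ∃ N, IsOpen N ∧ d ∈ N ∧ (D ∩ N).Finite) : DiscreteTopology D := by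
  rw [discreteTopology_iff_isOpen_singleton]
  rintro ⟨d, hd⟩
  obtain ⟨N, hNo, hdN, hfin⟩ := h d hd
  refine ⟨N \ ((D ∩ N) \ {d}), hNo.sdiff (hfin.subset sdiff_subset).isClosed, ?_⟩
  ext ⟨x, hx⟩
  simp only [mem_preimage, Set.mem_sdiff, mem_inter_iff, mem_singleton_iff, Subtype.mk.injEq]
  constructor
  · rintro ⟨hxN, hx'⟩
    by_contra hne
    exact hx' ⟨⟨hx, hxN⟩, hne⟩
  · rintro rfl
    exact ⟨hdN, fun h => h.2 rfl⟩

/-- Countable tightness at every point of a countable set is witnessed by a single countable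
set. -/
lemma exists_countable_subset_closure {X : Type*} [TopologicalSpace X] {A : Set X}
    (hA : A.Countable) (htight : ∀ x ∈ A, CountableTightnessAt x) {Z : Set X}
    (hZ : A ⊆ closure Z) : ∃ B ⊆ Z, B.Countable ∧ A ⊆ closure B := by
  choose! B hBZ hBc hB using fun x (hx : x ∈ A) => htight x hx Z (hZ hx)
  exact ⟨⋃ x ∈ A, B x, iUnion₂_subset hBZ, hA.biUnion hBc,
    fun x hx => closure_mono (subset_biUnion_of_mem hx) (hB x hx)⟩

/-- A countable set disjoint from a closed set `F` of a regular space avoids the intersection of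
the closures of some decreasing sequence of open neighbourhoods of `F`. -/
lemma exists_antitone_open_superset {X : Type*} [TopologicalSpace X] [RegularSpace X]
    {F B : Set X} (hF : IsClosed F) (hB : B.Countable) (hd : Disjoint B F) :
    ∃ W : ℕ → Set X, (∀ n, IsOpen (W n)) ∧ Antitone W ∧ (∀ n, F ⊆ W n) ∧
      Disjoint B (⋂ n, closure (W n)) := by
  have hsep : ∀ b ∈ B, ∃ U, IsOpen U ∧ F ⊆ U ∧ b ∉ closure U := by
    intro b hb
    obtain ⟨K, hK, hKc, hKF⟩ := exists_mem_nhds_isClosed_subset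
      (hF.isOpen_compl.mem_nhds (disjoint_left.1 hd hb))
    refine ⟨Kᶜ, hKc.isOpen_compl, subset_compl_comm.1 hKF, ?_⟩
    rw [closure_compl, notMem_compl_iff]
    exact mem_interior_iff_mem_nhds.2 hK
  choose! U hUo hFU hbU using hsep
  rcases B.eq_empty_or_nonempty with rfl | hne
  · exact ⟨fun _ => univ, fun _ => isOpen_univ, antitone_const, fun _ => subset_univ _,
      empty_disjoint _⟩
  obtain ⟨b, rfl⟩ := hB.exists_eq_range hne
  refine ⟨fun n => ⋂ i ∈ Iic n, U (b i),
    fun n => (finite_Iic n).isOpen_biInter fun i _ => hUo _ ⟨i, rfl⟩,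
    fun _ _ h => biInter_subset_biInter_left (Iic_subset_Iic.2 h),
    fun n => subset_iInter₂ fun i _ => hFU _ ⟨i, rfl⟩, disjoint_left.2 ?_⟩
  rintro _ ⟨i, rfl⟩ h
  have hsub : ⋂ j ∈ Iic i, U (b j) ⊆ U (b i) := biInter_subset_of_mem (self_mem_Iic (a := i))
  exact hbU _ ⟨i, rfl⟩ (closure_mono hsub (mem_iInter.1 h i))

/-- In a regular countably compact space, every countable nowhere dense set of points of
countable tightness is contained in the closure of a countable discrete subset of any
given dense set. -/
theorem stmt2 {X : Type*} [TopologicalSpace X] [T1Space X] [RegularSpace X]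
    (hcc : CountablyCompactSp X) (S : Set X) (hS : Dense S)
    (A : Set X) (hAcount : A.Countable) (hAnwd : IsNowhereDense A)
    (htight : ∀ x ∈ A, CountableTightnessAt x) :
    ∃ D ⊆ S, D.Countable ∧ DiscreteTopology D ∧ A ⊆ closure D := by
  obtain ⟨B, hBA, hBc, hAB⟩ := exists_countable_subset_closure hAcount htight
    (Z := (closure A)ᶜ) (by rw [(interior_eq_empty_iff_dense_compl.1 hAnwd).closure_eq]
                            exact subset_univ _)
  obtain ⟨W, hWo, hWanti, hFW, hBW⟩ := exists_antitone_open_superset isClosed_closure hBc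
    (disjoint_left.2 hBA)
  have hAW : ∀ n, A ⊆ W n := fun n => subset_closure.trans (hFW n)
  set G := ⋂ n, closure (W n) with hG
  have hGc : IsClosed G := isClosed_iInter fun _ => isClosed_closure
  let Z : Set X := {z | ∃ D ⊆ S, Disjoint D G ∧ (∀ n, (D \ W n).Finite) ∧
    ∀ n, z ∈ closure (D ∩ W n)}
  have hAZ : A ⊆ closure Z := by
    intro a ha
    rw [mem_closure_iff_nhds]
    intro V hV
    obtain ⟨K, hK, hKc, hKV⟩ := exists_mem_nhds_isClosed_subset hV
    have hd : ∀ n, ∃ d ∈ S, d ∈ K ∧ d ∈ W n ∧ d ∉ G := by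
      intro n
      have hO : IsOpen (interior K ∩ W n) := isOpen_interior.inter (hWo n)
      obtain ⟨b, hbO, hbB⟩ := mem_closure_iff.1 (hAB ha) _ hO
        ⟨mem_interior_iff_mem_nhds.2 hK, hAW n ha⟩
      obtain ⟨d, hdO, hdS⟩ := hS.inter_open_nonempty _ (hO.sdiff hGc)
        ⟨b, hbO, disjoint_left.1 hBW hbB⟩
      exact ⟨d, hdS, interior_subset hdO.1.1, hdO.1.2, hdO.2⟩
    choose d hdS hdK hdW hdG using hd
    obtain ⟨z, hz⟩ := hcc.exists_mem_closure_tails d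
    refine ⟨z, hKV ?_, range d, range_subset_iff.2 hdS, ?_, fun n => ?_, fun n => ?_⟩
    · exact closure_minimal (image_subset_iff.2 fun i _ => hdK i) hKc (hz 0)
    · rw [disjoint_left]
      rintro _ ⟨i, rfl⟩
      exact hdG i
    · refine ((finite_Iio n).image d).subset ?_
      rintro _ ⟨⟨i, rfl⟩, hi⟩
      exact ⟨i, not_le.1 fun h => hi (hWanti h (hdW i)), rfl⟩
    · refine closure_mono ?_ (hz n)
      rintro _ ⟨i, hi, rfl⟩
      exact ⟨⟨i, rfl⟩, hWanti hi (hdW i)⟩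
  obtain ⟨Z', hZ'Z, hZ'c, hAZ'⟩ := exists_countable_subset_closure hAcount htight hAZ
  have hE : ∀ z ∈ Z', ∃ D ⊆ S, Disjoint D G ∧ (∀ n, (D \ W n).Finite) ∧
      ∀ n, z ∈ closure (D ∩ W n) := fun z hz => hZ'Z hz
  choose! E hES hEG hEfin hEcl using hE
  obtain ⟨e, he⟩ := countable_iff_exists_injOn.1 hZ'c
  let D : Set X := ⋃ z ∈ Z', E z ∩ W (e z)
  have hDG : Disjoint D G := by
    simp only [D, disjoint_iUnion_left]
    exact fun z hz => (hEG z hz).mono_left inter_subset_left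
  have hDfin : ∀ n, (D \ W n).Finite := by
    intro n
    have hfin : (Z' ∩ e ⁻¹' Iio n).Finite :=
      Finite.of_finite_image ((finite_Iio n).subset (image_subset_iff.2 inter_subset_right))
        (he.mono inter_subset_left)
    refine (hfin.biUnion fun z hz => hEfin z hz.1 n).subset ?_
    rintro x ⟨hx, hxn⟩
    obtain ⟨z, hz, hxE, hxW⟩ := mem_iUnion₂.1 hx
    exact mem_iUnion₂.2 ⟨z, ⟨hz, not_le.1 fun h => hxn (hWanti h hxW)⟩, hxE, hxn⟩
  have hDout : ∀ x ∈ D, ∃ n, x ∉ closure (W n) := by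
    intro x hx
    simpa [hG] using disjoint_left.1 hDG hx
  refine ⟨D, iUnion₂_subset fun z hz => inter_subset_left.trans (hES z hz), ?_, ?_, ?_⟩
  · refine (countable_iUnion fun n => (hDfin n).countable).mono fun x hx => ?_
    obtain ⟨n, hn⟩ := hDout x hx
    exact mem_iUnion.2 ⟨n, hx, fun h => hn (subset_closure h)⟩
  · refine discreteTopology_of_locally_finite D fun x hx => ?_
    obtain ⟨n, hn⟩ := hDout x hx
    exact ⟨(closure (W n))ᶜ, isClosed_closure.isOpen_compl, hn,
      (hDfin n).subset fun y hy => ⟨hy.1, fun h => hy.2 (subset_closure h)⟩⟩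
  · refine hAZ'.trans (closure_minimal (fun z hz => ?_) isClosed_closure)
    exact closure_mono (subset_biUnion_of_mem (u := fun z => E z ∩ W (e z)) hz) (hEcl z hz (e z))
end

section
/- Let X be a regular, countably tight T1 space (X has countable tightness at every point) such that every countable discrete subspace of X has compact closure in X. Then every countable nowhere dense subset of X has compact closure in X. -/
open Set Topology Filter

/-- The subspace `D` is discrete: each of its points is isolated in `D`. -/
def IsRelDiscrete {X : Type*} [TopologicalSpace X] (D : Set X) : Prop :=
  ∀ x ∈ D, ∃ W ∈ 𝓝 x, W ∩ D ⊆ {x}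

theorem IsRelDiscrete.discreteTopology {X : Type*} [TopologicalSpace X] {D : Set X}
    (hD : IsRelDiscrete D) : DiscreteTopology D := by
  rw [discreteTopology_subtype_iff]
  intro x hx
  obtain ⟨W, hW, hWD⟩ := hD x hx
  rw [← Filter.empty_mem_iff_bot]
  filter_upwards [mem_inf_of_left (mem_nhdsWithin_of_mem_nhds hW),
    mem_inf_of_left self_mem_nhdsWithin, mem_inf_of_right (mem_principal_self D)]
    with y hyW hyx hyD
  exact hyx (hWD ⟨hyW, hyD⟩)

/-- A discrete set can be enlarged inside `S ∪ D`, away from the closed set `K`, to a discrete set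
accumulating at a point of `closure D` outside `K`. -/
theorem IsRelDiscrete.exists_extension {X : Type*} [TopologicalSpace X] [RegularSpace X]
    {S D K : Set X} {c : X} (hS : IsRelDiscrete S) (hD : IsRelDiscrete D)
    (hK : IsClosed K) (hcK : c ∉ K) (hcD : c ∈ closure D) :
    ∃ T, S ⊆ T ∧ T ⊆ S ∪ D ∧ IsRelDiscrete T ∧ c ∈ closure T ∧
      ∀ x ∈ T, x ∈ K → x ∈ S := by
  by_cases hcS : c ∈ closure S
  · exact ⟨S, Subset.rfl, subset_union_left, hS, hcS, fun x hx _ => hx⟩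
  have hc : (closure S ∪ K)ᶜ ∈ 𝓝 c :=
    (isClosed_closure.union hK).isOpen_compl.mem_nhds (by simp [hcS, hcK])
  obtain ⟨N, hN, hNc, hNS⟩ := exists_mem_nhds_isClosed_subset hc
  refine ⟨S ∪ (D ∩ N), subset_union_left, union_subset_union_right _ inter_subset_left, ?_, ?_, ?_⟩
  · rintro x (hx | ⟨hxD, hxN⟩)
    · obtain ⟨W, hW, hWS⟩ := hS x hx
      have hxN : x ∉ N := fun h => hNS h (Or.inl (subset_closure hx))
      refine ⟨W ∩ Nᶜ, inter_mem hW (hNc.isOpen_compl.mem_nhds hxN), ?_⟩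
      rintro y ⟨⟨hyW, hyN⟩, hyS | hyD⟩
      · exact hWS ⟨hyW, hyS⟩
      · exact absurd hyD.2 hyN
    · obtain ⟨W, hW, hWD⟩ := hD x hxD
      have hxS : x ∉ closure S := fun h => hNS hxN (Or.inl h)
      refine ⟨W ∩ (closure S)ᶜ, inter_mem hW (isClosed_closure.isOpen_compl.mem_nhds hxS), ?_⟩
      rintro y ⟨⟨hyW, hyS'⟩, hyS | hyD⟩
      · exact absurd (subset_closure hyS) hyS'
      · exact hWD ⟨hyW, hyD.1⟩
  · refine closure_mono subset_union_right ?_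
    rw [mem_closure_iff_nhds] at hcD ⊢
    intro V hV
    obtain ⟨y, ⟨hyV, hyN⟩, hyD⟩ := hcD (V ∩ N) (inter_mem hV hN)
    exact ⟨y, hyV, hyD, hyN⟩
  · rintro x (hx | ⟨-, hxN⟩) hxK
    · exact hx
    · exact absurd (Or.inr hxK) (hNS hxN)

/-- Countably many discrete subsets of a countable set `B` can be merged into a single one, as far
as accumulation at points of a closed set disjoint from `B` is concerned. -/
theorem exists_isRelDiscrete_subset_closure {X : Type*} [TopologicalSpace X] [RegularSpace X]
    {B C F : Set X} (hB : B.Countable) (hC : C.Countable) (hF : IsClosed F)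
    (hBF : Disjoint B F) (hCF : C ⊆ F)
    (h : ∀ c ∈ C, ∃ D ⊆ B, IsRelDiscrete D ∧ c ∈ closure D) :
    ∃ D ⊆ B, IsRelDiscrete D ∧ C ⊆ closure D := by
  rcases C.eq_empty_or_nonempty with rfl | hCne
  · exact ⟨∅, empty_subset _, fun x hx => hx.elim, empty_subset _⟩
  have hBne : B.Nonempty := by
    obtain ⟨c, hc⟩ := hCne
    obtain ⟨D, hDB, -, hcD⟩ := h c hc
    exact (closure_nonempty_iff.1 ⟨c, hcD⟩).mono hDB
  obtain ⟨c, rfl⟩ := hC.exists_eq_range hCne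
  obtain ⟨b, rfl⟩ := hB.exists_eq_range hBne
  have hW : ∀ i, ∃ W ∈ 𝓝 (b i), IsClosed W ∧ W ⊆ Fᶜ := fun i =>
    exists_mem_nhds_isClosed_subset
      (hF.isOpen_compl.mem_nhds (disjoint_left.1 hBF (mem_range_self i)))
  choose W hWb hWc hWF using hW
  have step : ∀ (n : ℕ) (S : {S : Set X // S ⊆ range b ∧ IsRelDiscrete S}),
      ∃ T : {S : Set X // S ⊆ range b ∧ IsRelDiscrete S}, S.1 ⊆ T.1 ∧ c n ∈ closure T.1 ∧
        ∀ i ≤ n, ∀ x ∈ T.1, x ∈ W i → x ∈ S.1 := by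
    rintro n ⟨S, hSB, hS⟩
    obtain ⟨D, hDB, hD, hcD⟩ := h (c n) (mem_range_self n)
    have hK : IsClosed (⋃ i ∈ Iic n, W i) := (finite_Iic n).isClosed_biUnion fun i _ => hWc i
    have hcK : c n ∉ ⋃ i ∈ Iic n, W i := by
      simp only [mem_iUnion, not_exists]
      exact fun i _ hi => hWF i hi (hCF (mem_range_self n))
    obtain ⟨T, hST, hTSD, hT, hcT, hTK⟩ := hS.exists_extension hD hK hcK hcD
    exact ⟨⟨T, hTSD.trans (union_subset hSB hDB), hT⟩, hST, hcT,
      fun i hi x hx hxW => hTK x hx (mem_biUnion (mem_Iic.2 hi) hxW)⟩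
  choose f hf hfc hfW using step
  let S : ℕ → {S : Set X // S ⊆ range b ∧ IsRelDiscrete S} :=
    fun n => Nat.rec ⟨∅, empty_subset _, fun x hx => hx.elim⟩ f n
  have hmono : Monotone fun n => (S n).1 := monotone_nat_of_le_succ fun n => hf n (S n)
  refine ⟨⋃ n, (S n).1, iUnion_subset fun n => (S n).2.1, ?_, ?_⟩
  · intro x hx
    obtain ⟨m, hm⟩ := mem_iUnion.1 hx
    obtain ⟨i, rfl⟩ := (S m).2.1 hm
    have hback : ∀ n, max i m ≤ n → ∀ y ∈ (S n).1, y ∈ W i → y ∈ (S (max i m)).1 := by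
      intro n hn
      induction n, hn using Nat.le_induction with
      | base => exact fun y hy _ => hy
      | succ n hn ih =>
        exact fun y hy hyW => ih y (hfW n (S n) i ((le_max_left i m).trans hn) y hy hyW) hyW
    obtain ⟨V, hV, hVS⟩ := (S (max i m)).2.2 (b i) (hmono (le_max_right i m) hm)
    refine ⟨V ∩ W i, inter_mem hV (hWb i), ?_⟩
    rintro y ⟨⟨hyV, hyW⟩, hy⟩
    obtain ⟨n, hn⟩ := mem_iUnion.1 hy
    exact hVS ⟨hyV, hback (max (max i m) n) (le_max_left _ _) y (hmono (le_max_right _ _) hn) hyW⟩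
  · rintro _ ⟨n, rfl⟩
    exact closure_mono (subset_iUnion (fun n => (S n).1) (n + 1)) (hfc n (S n))

/-- In a regular, countably tight space in which countable discrete sets have compact closure,
each point in the closure of a countable set `B` lies in the closure of a discrete subset
of `B`. -/
theorem exists_isRelDiscrete_mem_closure {X : Type*} [TopologicalSpace X] [T1Space X]
    [RegularSpace X] {c : X} (htight : CountableTightnessAt c)
    (hωD : ∀ D : Set X, D.Countable → DiscreteTopology D → IsCompact (closure D))
    {B : Set X} (hB : B.Countable) (hc : c ∈ closure B) :
    ∃ D ⊆ B, IsRelDiscrete D ∧ c ∈ closure D := by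
  by_cases hcB : c ∈ B
  · refine ⟨{c}, singleton_subset_iff.2 hcB, ?_, subset_closure rfl⟩
    exact fun x hx => ⟨univ, univ_mem, by rw [mem_singleton_iff.1 hx]; exact inter_subset_right⟩
  obtain ⟨b, rfl⟩ := hB.exists_eq_range (closure_nonempty_iff.1 ⟨c, hc⟩)
  have hO : ∀ n, ∃ O ∈ 𝓝 c, IsClosed O ∧ O ⊆ {b n}ᶜ := fun n =>
    exists_mem_nhds_isClosed_subset
      (isOpen_compl_singleton.mem_nhds fun h => hcB (h ▸ mem_range_self n))
  choose O hOc hOcl hOb using hO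
  set Z := ⋂ n, O n
  have hBZ : Disjoint (range b) Z := by
    rw [disjoint_left]
    rintro _ ⟨n, rfl⟩ h
    exact hOb n (mem_iInter.1 h n) rfl
  have hcP : c ∈ closure {z | z ∈ Z ∧ ∃ D ⊆ range b, IsRelDiscrete D ∧ z ∈ closure D} := by
    rw [mem_closure_iff_nhds]
    intro V hV
    obtain ⟨N, hN, hNcl, hNV⟩ := exists_mem_nhds_isClosed_subset hV
    have hd : ∀ n, ∃ x, x ∈ N ∩ (⋂ i ∈ Iic n, O i) ∩ range b := fun n =>
      mem_closure_iff_nhds.1 hc _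
        (inter_mem hN ((biInter_mem (finite_Iic n)).2 fun i _ => hOc i))
    choose d hd using hd
    have hdO : ∀ j n, j ≤ n → d n ∈ O j := fun j n hjn => mem_iInter₂.1 (hd n).1.2 j hjn
    have hD : IsRelDiscrete (range d) := by
      rintro _ ⟨m, rfl⟩
      obtain ⟨j, hj⟩ := (hd m).2
      have hfin : (d '' Iio j \ {d m}).Finite := ((finite_Iio j).image d).sdiff
      refine ⟨(O j)ᶜ ∩ (d '' Iio j \ {d m})ᶜ, inter_mem
        ((hOcl j).isOpen_compl.mem_nhds fun h => hOb j h hj.symm)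
        (hfin.isClosed.isOpen_compl.mem_nhds fun h => h.2 rfl), ?_⟩
      rintro _ ⟨⟨hyO, hyF⟩, n, rfl⟩
      by_contra hne
      exact hyF ⟨mem_image_of_mem d (not_le.1 fun hjn => hyO (hdO j n hjn)), hne⟩
    have hDc := hωD _ (countable_range d) hD.discreteTopology
    obtain ⟨z, hz, hzd⟩ := hDc.exists_mapClusterPt (u := d) (f := atTop)
      (tendsto_principal.2 (Eventually.of_forall fun n => subset_closure (mem_range_self n)))
    have hclosed : ∀ {G : Set X}, IsClosed G → (∀ᶠ n in atTop, d n ∈ G) → z ∈ G :=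
      fun hG hev => hG.mem_of_mapClusterPt hzd hev
    refine ⟨z, hNV (hclosed hNcl (Eventually.of_forall fun n => (hd n).1.1)),
      mem_iInter.2 fun j => hclosed (hOcl j) ?_, range d, ?_, hD, hz⟩
    · filter_upwards [eventually_ge_atTop j] with n hn using hdO j n hn
    · rintro _ ⟨n, rfl⟩
      exact (hd n).2
  obtain ⟨C, hCP, hC, hcC⟩ := htight _ hcP
  obtain ⟨D, hDB, hD, hCD⟩ := exists_isRelDiscrete_subset_closure hB hC
    (isClosed_iInter hOcl) hBZ (fun z hz => (hCP hz).1) (fun z hz => (hCP hz).2)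
  exact ⟨D, hDB, hD, closure_minimal hCD isClosed_closure hcC⟩

/-- A countably tight regular ωD-bounded space is ωN-bounded. -/
theorem stmt3 {X : Type*} [TopologicalSpace X] [T1Space X] [RegularSpace X]
    (htight : ∀ x : X, CountableTightnessAt x)
    (hωD : ∀ D : Set X, D.Countable → DiscreteTopology D → IsCompact (closure D)) :
    ∀ A : Set X, A.Countable → IsNowhereDense A → IsCompact (closure A) := by
  intro A hA hAnd
  have hdense : Dense (closure A)ᶜ := interior_eq_empty_iff_dense_compl.1 hAnd
  choose B hBA hB hxB using fun x => htight x _ (hdense x)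
  have hBc : (⋃ a ∈ A, B a).Countable := hA.biUnion fun a _ => hB a
  obtain ⟨D, hDB, hD, hAD⟩ := exists_isRelDiscrete_subset_closure hBc hA isClosed_closure
    (disjoint_left.2 fun x hx => (iUnion₂_subset fun a _ => hBA a) hx) subset_closure
    fun a ha => exists_isRelDiscrete_mem_closure (htight a) hωD hBc
      (closure_mono (subset_biUnion_of_mem ha) (hxB a))
  exact (hωD D (hBc.mono hDB) hD.discreteTopology).of_isClosed_subset isClosed_closure
    (closure_minimal hAD isClosed_closure)
end

section
/- Let X be a regular, countably compact T1 space with countable tightness at every point. Then X is discretely determined: for every set A ⊆ X and every point x in the closure of A, there is a subset D ⊆ A that is discrete in its subspace topology with x in the closure of D. -/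
open Set Topology Filter

/-- In a countably compact space every sequence has a cluster point. -/
theorem CountablyCompactSp.exists_forall_mem_closure_tail {X : Type*} [TopologicalSpace X]
    (hcc : CountablyCompactSp X) (b : ℕ → X) :
    ∃ y, ∀ n, y ∈ closure (b '' Ici n) := by
  by_contra! h
  obtain ⟨𝒱, h𝒱, hfin, hcov⟩ := hcc (range fun n => (closure (b '' Ici n))ᶜ)
    (countable_range _) (by rintro _ ⟨n, rfl⟩; exact isClosed_closure.isOpen_compl)
    (by
      ext y
      obtain ⟨n, hn⟩ := h y
      simp only [sUnion_range, mem_iUnion, mem_univ, iff_true]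
      exact ⟨n, hn⟩)
  obtain ⟨I, -, hI, hcov⟩ := (exists_subset_image_finite_and (p := fun 𝒲 => ⋃₀ 𝒲 = univ)).1
    ⟨𝒱, by rwa [image_univ], hfin, hcov⟩
  obtain ⟨N, hN⟩ := hI.bddAbove
  obtain ⟨_, ⟨n, hn, rfl⟩, hbn⟩ := hcov.symm ▸ mem_univ (b N)
  exact hbn (subset_closure ⟨N, hN hn, rfl⟩)

/-- A point of a regular space has a shrinking sequence of closed neighbourhoods that successively
miss prescribed other points. -/
theorem exists_seq_closed_nhds_notMem {X : Type*} [TopologicalSpace X] [T1Space X] [RegularSpace X]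
    (x : X) (a : ℕ → X) (ha : ∀ n, a n ≠ x) :
    ∃ C : ℕ → Set X, (∀ n, IsClosed (C n)) ∧ (∀ n, C n ∈ 𝓝 x) ∧
      (∀ n, C (n + 1) ⊆ interior (C n)) ∧ ∀ n, a n ∉ C (n + 1) := by
  have step : ∀ (n : ℕ) (S : {S : Set X // IsClosed S ∧ S ∈ 𝓝 x}),
      ∃ T : {S : Set X // IsClosed S ∧ S ∈ 𝓝 x}, T.1 ⊆ interior S.1 ∧ a n ∉ T.1 := by
    rintro n ⟨S, -, hS⟩
    obtain ⟨T, hT, hTc, hTS⟩ := exists_mem_nhds_isClosed_subset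
      (inter_mem (interior_mem_nhds.2 hS) (isOpen_ne.mem_nhds (ha n).symm))
    exact ⟨⟨T, hTc, hT⟩, fun z hz => (hTS hz).1, fun hz => (hTS hz).2 rfl⟩
  choose f hf using step
  let C : ℕ → {S : Set X // IsClosed S ∧ S ∈ 𝓝 x} :=
    fun n => Nat.rec ⟨univ, isClosed_univ, univ_mem⟩ f n
  exact ⟨fun n => (C n).1, fun n => (C n).2.1, fun n => (C n).2.2,
    fun n => (hf n (C n)).1, fun n => (hf n (C n)).2⟩

/-- A set is discrete if each of its points has a neighbourhood meeting it in a finite set. -/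
theorem discreteTopology_of_finite_inter_nhds {X : Type*} [TopologicalSpace X] [T1Space X]
    {D : Set X} (h : ∀ d ∈ D, ∃ W ∈ 𝓝 d, (D ∩ W).Finite) : DiscreteTopology D := by
  rw [discreteTopology_subtype_iff]
  intro d hd
  obtain ⟨W, hW, hfin⟩ := h d hd
  rw [← disjoint_iff, disjoint_principal_right, mem_nhdsWithin_iff_exists_mem_nhds_inter]
  refine ⟨W ∩ ((D ∩ W) \ {d})ᶜ,
    inter_mem hW ((hfin.subset sdiff_subset).isClosed.compl_mem_nhds (by simp)), ?_⟩
  rintro z ⟨⟨hzW, hz⟩, hzd⟩ hzD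
  exact hz ⟨⟨hzD, hzW⟩, hzd⟩

/-- Countably tight, regular, countably compact spaces are discretely determined. -/
theorem stmt4 {X : Type*} [TopologicalSpace X] [T1Space X] [RegularSpace X]
    (hcc : CountablyCompactSp X) (htight : ∀ x : X, CountableTightnessAt x) :
    ∀ (A : Set X) (x : X), x ∈ closure A →
      ∃ D ⊆ A, DiscreteTopology D ∧ x ∈ closure D := by
  intro A x hxA
  by_cases hx : x ∈ A
  · exact ⟨{x}, by simpa using hx, inferInstance, subset_closure rfl⟩
  obtain ⟨B, hBA, hBc, hxB⟩ := htight x A hxA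
  obtain ⟨a, rfl⟩ := hBc.exists_eq_range (closure_nonempty_iff.1 ⟨x, hxB⟩)
  have hax : ∀ n, a n ≠ x := fun n h => hx (h ▸ hBA ⟨n, rfl⟩)
  obtain ⟨C, hCc, hCx, hCs, hCa⟩ := exists_seq_closed_nhds_notMem x a hax
  have hanti : Antitone C := antitone_nat_of_succ_le fun n => (hCs n).trans interior_subset
  -- Subsets of `range a` almost contained in every `C n` are discrete; take the points of
  -- `⋂ n, C n` they accumulate at.
  let E : Set X := {e | (∀ n, e ∈ C n) ∧
    ∃ D ⊆ range a, (∀ n, (D \ C n).Finite) ∧ e ∈ closure D}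
  have hxE : x ∈ closure E := by
    rw [mem_closure_iff_nhds]
    intro V hV
    obtain ⟨V', hV', hV'c, hV'V⟩ := exists_mem_nhds_isClosed_subset hV
    have hb : ∀ n, ∃ b, b ∈ V' ∩ C n ∧ b ∈ range a := fun n =>
      mem_closure_iff_nhds.1 hxB _ (inter_mem hV' (hCx n))
    choose b hbVC hba using hb
    obtain ⟨y, hy⟩ := hcc.exists_forall_mem_closure_tail b
    refine ⟨y, hV'V ?_, fun n => ?_, range b, range_subset_iff.2 hba, fun n => ?_,
      closure_mono (image_subset_range _ _) (hy 0)⟩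
    · refine closure_minimal ?_ hV'c (hy 0)
      rintro _ ⟨m, -, rfl⟩
      exact (hbVC m).1
    · refine closure_minimal ?_ (hCc n) (hy n)
      rintro _ ⟨m, hm, rfl⟩
      exact hanti hm (hbVC m).2
    · refine ((finite_Iio n).image b).subset ?_
      rintro _ ⟨⟨m, rfl⟩, hm⟩
      exact ⟨m, not_le.1 fun hnm => hm (hanti hnm (hbVC m).2), rfl⟩
  obtain ⟨F, hFE, hFc, hxF⟩ := htight x E hxE
  obtain ⟨e, rfl⟩ := hFc.exists_eq_range (closure_nonempty_iff.1 ⟨x, hxF⟩)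
  have he : ∀ n, e n ∈ E := fun n => hFE ⟨n, rfl⟩
  choose heC D hDa hDfin heD using he
  refine ⟨⋃ n, D n ∩ C n, iUnion_subset fun n => inter_subset_left.trans ((hDa n).trans hBA),
    discreteTopology_of_finite_inter_nhds fun d hd => ?_, ?_⟩
  · obtain ⟨n, hdn, -⟩ := mem_iUnion.1 hd
    obtain ⟨k, rfl⟩ := hDa n hdn
    refine ⟨(C (k + 1))ᶜ, (hCc _).compl_mem_nhds (hCa k),
      ((finite_Iio (k + 1)).biUnion fun m _ => hDfin m (k + 1)).subset ?_⟩
    rintro z ⟨hz, hzC⟩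
    obtain ⟨m, hzm, hzCm⟩ := mem_iUnion.1 hz
    exact mem_biUnion (show m ∈ Iio (k + 1) from
      not_le.1 fun hkm => hzC (hanti hkm hzCm)) ⟨hzm, hzC⟩
  · refine closure_minimal (range_subset_iff.2 fun n => ?_) isClosed_closure hxF
    refine closure_mono (subset_iUnion (fun n => D n ∩ C n) n) ?_
    rw [mem_closure_iff_nhds]
    intro V hV
    obtain ⟨z, ⟨hzV, hzC⟩, hzD⟩ := mem_closure_iff_nhds.1 (heD n) _
      (inter_mem hV (isOpen_interior.mem_nhds (hCs n (heC n (n + 1)))))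
    exact ⟨z, hzV, hzD, interior_subset hzC⟩
end

section
/- Assume 𝔟 > ω₁. Let X be a regular T1 space with countable tightness at every point such that every countable discrete subspace of X has compact closure in X. Then every countable subset of X has compact closure in X. -/
open Set Topology Filter Cardinal

/-- The bounding number `𝔟`: the least cardinality of a family of functions `ℕ → ℕ`
unbounded in the eventual domination order. -/
noncomputable def boundingNumber : Cardinal :=
  sInf {c : Cardinal | ∃ F : Set (ℕ → ℕ), #(↥F) = c ∧
    ∀ g : ℕ → ℕ, ∃ f ∈ F, ¬ ∀ᶠ n in Filter.atTop, f n ≤ g n}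

/-- A family of at most `ℵ₁` functions is eventually dominated when `𝔟 > ω₁`. -/
theorem exists_eventually_dominating (hb : Cardinal.aleph 1 < boundingNumber)
    (F : Set (ℕ → ℕ)) (hF : #F ≤ Cardinal.aleph 1) :
    ∃ g : ℕ → ℕ, ∀ f ∈ F, ∀ᶠ n in Filter.atTop, f n ≤ g n := by
  by_contra h
  have hle : boundingNumber ≤ #F := csInf_le' ⟨F, rfl, by
    intro g
    by_contra! hg
    exact h ⟨g, hg⟩⟩
  exact absurd (hle.trans hF) (not_le.mpr hb)

theorem IsCompact.exists_subset_of_monotone {X : Type*} [TopologicalSpace X] {K : Set X}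
    (hK : IsCompact K) {W : ℕ → Set X} (hWo : ∀ n, IsOpen (W n)) (hWm : Monotone W)
    (hKW : K ⊆ ⋃ n, W n) : ∃ n, K ⊆ W n :=
  hK.elim_directed_cover W hWo hKW hWm.directed_le

/-- A set covered by increasing open sets, each containing finitely many of its points, is
discrete. -/
theorem discreteTopology_of_finite_inter {X : Type*} [TopologicalSpace X] [T1Space X]
    {D : Set X} {W : ℕ → Set X} (hWo : ∀ n, IsOpen (W n)) (hDW : D ⊆ ⋃ n, W n)
    (hfin : ∀ n, (D ∩ W n).Finite) : DiscreteTopology D := by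
  refine discreteTopology_subtype_iff'.mpr fun x hx => ?_
  obtain ⟨n, hn⟩ := mem_iUnion.mp (hDW hx)
  refine ⟨W n \ ((D ∩ W n) \ {x}), (hWo n).sdiff ((hfin n).subset sdiff_subset).isClosed, ?_⟩
  ext y
  constructor
  · rintro ⟨⟨h1, h2⟩, h3⟩
    by_contra hyx
    exact h2 ⟨⟨h3, h1⟩, hyx⟩
  · rintro rfl
    exact ⟨⟨hn, fun h => h.2 rfl⟩, hx⟩

/-- In a space whose countable discrete subspaces have compact closure, countable compactness of
closed sets, for increasing covers. -/
theorem exists_subset_of_discrete_compact {X : Type*} [TopologicalSpace X] [T1Space X]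
    (hωD : ∀ D : Set X, D.Countable → DiscreteTopology D → IsCompact (closure D))
    {C : Set X} (hC : IsClosed C) {W : ℕ → Set X} (hWo : ∀ n, IsOpen (W n)) (hWm : Monotone W)
    (hCW : C ⊆ ⋃ n, W n) : ∃ n, C ⊆ W n := by
  by_contra! h
  choose x hxC hxW using fun n => not_subset.mp (h n)
  have hsub : range x ⊆ C := range_subset_iff.mpr hxC
  have hdisc : DiscreteTopology (range x) := by
    refine discreteTopology_of_finite_inter hWo (hsub.trans hCW) fun n => ?_
    refine ((finite_Iio n).image x).subset ?_
    rintro _ ⟨⟨k, rfl⟩, hk⟩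
    refine ⟨k, ?_, rfl⟩
    by_contra hkn
    exact hxW k (hWm (not_lt.mp hkn) hk)
  obtain ⟨n, hn⟩ := (hωD _ (countable_range x) hdisc).exists_subset_of_monotone hWo hWm
    ((closure_minimal hsub hC).trans hCW)
  exact hxW n (hn (subset_closure ⟨n, rfl⟩))

/-- If `𝔟 > ω₁`, sets of size at most `ℵ₁` have compact closure when they lie in the closure of a
sequence but off the closures of increasing open sets that cover the sequence. -/
theorem isCompact_closure_of_card_le_aleph_one (hb : Cardinal.aleph 1 < boundingNumber)
    {X : Type} [TopologicalSpace X] [T1Space X] [RegularSpace X]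
    (htight : ∀ x : X, CountableTightnessAt x)
    (hωD : ∀ D : Set X, D.Countable → DiscreteTopology D → IsCompact (closure D))
    {e : ℕ → X} {W : ℕ → Set X} (hWo : ∀ n, IsOpen (W n)) (hWm : Monotone W)
    (heW : ∀ m, ∃ n, e m ∈ W n) {S : Set X} (hSe : S ⊆ closure (range e))
    (hSW : ∀ n, Disjoint (closure (W n)) S) (hS : #S ≤ Cardinal.aleph 1) :
    IsCompact (closure S) := by
  classical
  let r : ℕ → ℕ := fun m => Nat.find (heW m)
  have hr : ∀ m n, e m ∈ W n ↔ r m ≤ n := fun m n =>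
    ⟨fun h => Nat.find_min' _ h, fun h => hWm h (Nat.find_spec (heW m))⟩
  let D : (ℕ → ℕ) → Set X := fun f => e '' {m | m ≤ f (r m)}
  have hDfin : ∀ f n, (D f ∩ W n).Finite := by
    intro f n
    refine ((finite_Iic ((Finset.range (n + 1)).sup f)).image e).subset ?_
    rintro _ ⟨⟨m, hm, rfl⟩, hmW⟩
    have hmn : r m ∈ Finset.range (n + 1) := Finset.mem_range.mpr (by
      have := (hr m n).mp hmW
      omega)
    exact ⟨m, le_trans (show m ≤ f (r m) from hm) (Finset.le_sup (f := f) hmn), rfl⟩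
  have hrange : range e ⊆ ⋃ n, W n := by
    rintro _ ⟨m, rfl⟩
    exact mem_iUnion.mpr (heW m)
  have hDe : ∀ f, D f ⊆ range e := fun f => image_subset_range _ _
  have hDc : ∀ f, IsCompact (closure (D f)) := fun f =>
    hωD _ ((countable_range e).mono (hDe f))
      (discreteTopology_of_finite_inter hWo ((hDe f).trans hrange) (hDfin f))
  let H : (ℕ → ℕ) → Set X := fun f => closure (D f) \ ⋃ n, W n
  have hHcl : ∀ f, IsClosed (H f) := fun f => isClosed_closure.sdiff (isOpen_iUnion hWo)
  have hHmono : ∀ f g : ℕ → ℕ, (∀ᶠ n in atTop, f n ≤ g n) → H f ⊆ H g := by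
    rintro f g hfg z ⟨hz, hzW⟩
    refine ⟨?_, hzW⟩
    obtain ⟨N, hN⟩ := eventually_atTop.mp hfg
    have hsub : D f ⊆ D g ∪ (D f ∩ W N) := by
      rintro _ ⟨m, hm, rfl⟩
      rcases le_total (r m) N with h | h
      · exact Or.inr ⟨⟨m, hm, rfl⟩, (hr m N).mpr h⟩
      · exact Or.inl ⟨m, le_trans (show m ≤ f (r m) from hm) (hN _ h), rfl⟩
    have hz' := closure_mono hsub hz
    rw [closure_union, (hDfin f N).isClosed.closure_eq] at hz'
    rcases hz' with h | h
    · exact h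
    · exact absurd (mem_iUnion.mpr ⟨N, h.2⟩) hzW
  have hbound : ∀ B : Set X, B ⊆ ⋃ f, H f → #B ≤ Cardinal.aleph 1 → ∃ g, B ⊆ H g := by
    intro B hB hcard
    choose f hf using fun b : B => mem_iUnion.mp (hB b.2)
    obtain ⟨g, hg⟩ := exists_eventually_dominating hb (range f) (mk_range_le.trans hcard)
    exact ⟨g, fun b hbB => hHmono _ _ (hg _ ⟨⟨b, hbB⟩, rfl⟩) (hf ⟨b, hbB⟩)⟩
  have hSH : S ⊆ ⋃ f, H f := by
    intro y hy
    have hcl : y ∈ closure (⋃ f, H f) := by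
      rw [mem_closure_iff_nhds_basis (closed_nhds_basis y)]
      rintro V ⟨hVy, hVc⟩
      have hex : ∀ n, ∃ m, e m ∈ V ∧ e m ∉ W n := by
        intro n
        have hyW : (closure (W n))ᶜ ∈ 𝓝 y :=
          isClosed_closure.isOpen_compl.mem_nhds fun h => (hSW n).ne_of_mem h hy rfl
        obtain ⟨_, ⟨h1, h2⟩, m, rfl⟩ :=
          mem_closure_iff_nhds.mp (hSe hy) _ (inter_mem hVy hyW)
        exact ⟨m, h1, fun h => h2 (subset_closure h)⟩
      choose m hmV hmW using hex
      let f : ℕ → ℕ := fun k => (Finset.range k).sup m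
      have hsub : range (e ∘ m) ⊆ D f := by
        rintro _ ⟨n, rfl⟩
        refine ⟨m n, ?_, rfl⟩
        have hn : n < r (m n) := not_le.mp fun h => hmW n ((hr _ _).mpr h)
        exact Finset.le_sup (f := m) (Finset.mem_range.mpr hn)
      have hcomp : IsCompact (closure (range (e ∘ m))) :=
        (hDc f).of_isClosed_subset isClosed_closure (closure_mono hsub)
      have hnot : ¬ closure (range (e ∘ m)) ⊆ ⋃ n, W n := by
        intro h
        obtain ⟨n, hn⟩ := hcomp.exists_subset_of_monotone hWo hWm h
        exact hmW n (hn (subset_closure ⟨n, rfl⟩))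
      obtain ⟨z, hz, hzW⟩ := not_subset.mp hnot
      exact ⟨z, mem_iUnion.mpr ⟨f, closure_mono hsub hz, hzW⟩,
        closure_minimal (range_subset_iff.mpr hmV) hVc hz⟩
    obtain ⟨B, hBH, hBc, hyB⟩ := htight y _ hcl
    obtain ⟨g, hg⟩ := hbound B hBH ((le_aleph0_iff_set_countable.mpr hBc).trans
      (aleph0_le_aleph 1))
    exact mem_iUnion.mpr ⟨g, closure_minimal hg (hHcl g) hyB⟩
  obtain ⟨g, hg⟩ := hbound S hSH hS
  exact (hDc g).of_isClosed_subset isClosed_closure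
    (closure_minimal (hg.trans sdiff_subset) isClosed_closure)

/-- If increasing countable open covers of `C` have a member containing `C`, then countable open
covers of `C` have finite subcovers. -/
theorem exists_finset_cover_of_countable {X ι : Type*} [TopologicalSpace X] {C : Set X}
    (hC : ∀ W : ℕ → Set X, (∀ n, IsOpen (W n)) → Monotone W → C ⊆ ⋃ n, W n → ∃ n, C ⊆ W n)
    {U : ι → Set X} (hUo : ∀ i, IsOpen (U i)) {J : Set ι} (hJ : J.Countable)
    (hCJ : C ⊆ ⋃ i ∈ J, U i) : ∃ t : Finset ι, C ⊆ ⋃ i ∈ t, U i := by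
  classical
  rcases J.eq_empty_or_nonempty with rfl | hne
  · exact ⟨∅, by simpa using hCJ⟩
  obtain ⟨j, rfl⟩ := hJ.exists_eq_range hne
  obtain ⟨n, hn⟩ := hC (fun n => ⋃ k ∈ Iio n, U (j k))
    (fun n => isOpen_biUnion fun k _ => hUo _)
    (fun m n hmn => biUnion_subset_biUnion_left (Iio_subset_Iio hmn))
    (fun x hx => by
      obtain ⟨_, ⟨k, rfl⟩, hk⟩ := mem_iUnion₂.mp (hCJ hx)
      exact mem_iUnion.mpr ⟨k + 1, mem_iUnion₂.mpr ⟨k, Nat.lt_succ_self k, hk⟩⟩)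
  refine ⟨(Finset.range n).image j, fun x hx => ?_⟩
  obtain ⟨k, hk, hxk⟩ := mem_iUnion₂.mp (hn hx)
  exact mem_iUnion₂.mpr ⟨j k, Finset.mem_image_of_mem j (Finset.mem_range.mpr hk), hxk⟩

/-- A well-ordered type of size `ℵ₁` in which initial segments are countable and countable sets
are strictly bounded. -/
theorem exists_omega_one_type : ∃ (I : Type) (_ : LinearOrder I), WellFoundedLT I ∧
    #I = Cardinal.aleph 1 ∧ (∀ a : I, (Iio a).Countable) ∧
    ∀ B : Set I, B.Countable → ∃ a, ∀ b ∈ B, b < a := by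
  have hIio : ∀ a : (Cardinal.aleph 1).ord.ToType, (Iio a).Countable := fun a =>
    le_aleph0_iff_set_countable.mp (lt_aleph_one_iff.mp
      ((mk_Iio_lt a (by simp)).trans_eq (mk_ord_toType _)))
  refine ⟨(Cardinal.aleph 1).ord.ToType, inferInstance, inferInstance, mk_ord_toType _, hIio,
    fun B hB => ?_⟩
  by_contra! h
  have huniv : (univ : Set (Cardinal.aleph 1).ord.ToType).Countable := by
    refine (hB.biUnion fun b _ => (countable_singleton b).union (hIio b)).mono fun a _ => ?_
    obtain ⟨b, hb, hab⟩ := h a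
    exact mem_iUnion₂.mpr ⟨b, hb, hab.eq_or_lt⟩
  have hlt := lt_aleph_one_iff.mpr (le_aleph0_iff_set_countable.mpr huniv)
  rw [mk_univ, mk_ord_toType] at hlt
  exact lt_irrefl _ hlt

/-- In a countably tight space, a closed set is compact as soon as its subsets of size at most
`ℵ₁` have compact closure. -/
theorem isCompact_of_card_le_aleph_one {X : Type} [TopologicalSpace X]
    (htight : ∀ x : X, CountableTightnessAt x) {G : Set X} (hG : IsClosed G)
    (hGc : ∀ S ⊆ G, #S ≤ Cardinal.aleph 1 → IsCompact (closure S)) : IsCompact G := by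
  refine isCompact_of_finite_subcover fun {ι} U hUo hGU => ?_
  by_contra! hno
  have hctble : ∀ S ⊆ G, S.Countable → IsCompact (closure S) := fun S hS hc =>
    hGc S hS ((le_aleph0_iff_set_countable.mpr hc).trans (aleph0_le_aleph 1))
  have hmono : ∀ W : ℕ → Set X, (∀ n, IsOpen (W n)) → Monotone W → G ⊆ ⋃ n, W n →
      ∃ n, G ⊆ W n := by
    intro W hWo hWm hGW
    by_contra! h
    choose x hxG hxW using fun n => not_subset.mp (h n)
    have hsub : range x ⊆ G := range_subset_iff.mpr hxG
    obtain ⟨n, hn⟩ := (hctble _ hsub (countable_range x)).exists_subset_of_monotone hWo hWm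
      ((closure_minimal hsub hG).trans hGW)
    exact hxW n (hn (subset_closure ⟨n, rfl⟩))
  obtain ⟨x₀, -, -⟩ := not_subset.mp (hno ∅)
  have hp : ∀ J : Set ι, ∃ x, J.Countable → x ∈ G ∧ x ∉ ⋃ i ∈ J, U i := by
    intro J
    by_cases hJ : J.Countable
    · have hcov : ¬ G ⊆ ⋃ i ∈ J, U i := fun h => by
        obtain ⟨t, ht⟩ := exists_finset_cover_of_countable hmono hUo hJ h
        exact hno t ht
      obtain ⟨x, hx⟩ := not_subset.mp hcov
      exact ⟨x, fun _ => hx⟩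
    · exact ⟨x₀, fun h => absurd h hJ⟩
  choose p hp using hp
  have hT : ∀ S : Set X, ∃ t : Finset ι, S ⊆ G → S.Countable → closure S ⊆ ⋃ i ∈ t, U i := by
    intro S
    by_cases hS : S ⊆ G ∧ S.Countable
    · obtain ⟨t, ht⟩ := (hctble S hS.1 hS.2).elim_finite_subcover U hUo
        ((closure_minimal hS.1 hG).trans hGU)
      exact ⟨t, fun _ _ => ht⟩
    · exact ⟨∅, fun h1 h2 => absurd ⟨h1, h2⟩ hS⟩
  choose T hT using hT
  obtain ⟨I, _, _, hIcard, hIio, hIbdd⟩ := exists_omega_one_type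
  obtain ⟨J, hJ⟩ : ∃ J : I → Set ι, ∀ a,
      J a = ↑(T ((fun b => p (J b)) '' Iio a)) ∪ ⋃ b ∈ Iio a, J b := by
    let step : ∀ a : I, (∀ b, b < a → Set ι) → Set ι := fun a ih =>
      ↑(T (range fun b : Iio a => p (ih b b.2))) ∪ ⋃ (b : I) (hb : b < a), ih b hb
    refine ⟨IsWellFounded.fix (· < ·) step, fun a => ?_⟩
    rw [IsWellFounded.fix_eq, image_eq_range]
    rfl
  have hJc : ∀ a, (J a).Countable := by
    intro a
    induction a using WellFoundedLT.induction with
    | ind a ih =>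
      rw [hJ a]
      exact (Finset.countable_toSet _).union ((hIio a).biUnion ih)
  have hJm : Monotone J := by
    intro b a hba
    rcases hba.eq_or_lt with rfl | h
    · exact le_rfl
    · rw [hJ a]
      exact (subset_biUnion_of_mem (u := J) (show b ∈ Iio a from h)).trans subset_union_right
  have hpG : ∀ a, p (J a) ∈ G := fun a => (hp _ (hJc a)).1
  have hSG : range (fun a => p (J a)) ⊆ G := range_subset_iff.mpr hpG
  have hcomp : IsCompact (closure (range fun a => p (J a))) :=
    hGc _ hSG (mk_range_le.trans hIcard.le)
  have hne : Nonempty I := (hIbdd ∅ countable_empty).nonempty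
  obtain ⟨a, ha⟩ := hcomp.elim_directed_cover (fun a => ⋃ i ∈ J a, U i)
    (fun a => isOpen_biUnion fun i _ => hUo i)
    (fun z hz => by
      obtain ⟨B, hBS, hBc, hzB⟩ := htight z _ hz
      choose c hc using fun b : B => hBS b.2
      have : Countable B := hBc.to_subtype
      obtain ⟨a, ha⟩ := hIbdd (range c) (countable_range c)
      have hBa : B ⊆ (fun b => p (J b)) '' Iio a := fun b hb =>
        ⟨c ⟨b, hb⟩, ha _ ⟨_, rfl⟩, hc ⟨b, hb⟩⟩
      obtain ⟨i, hi, hzi⟩ := mem_iUnion₂.mp (hT _ ((image_subset_range _ _).trans hSG)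
        ((hIio a).image _) (closure_mono hBa hzB))
      exact mem_iUnion.mpr ⟨a, mem_iUnion₂.mpr ⟨i, by rw [hJ a]; exact Or.inl hi, hzi⟩⟩)
    (Monotone.directed_le fun b a hba => biUnion_subset_biUnion_left (hJm hba))
  exact (hp _ (hJc a)).2 (ha (subset_closure ⟨a, rfl⟩))

/-- If `𝔟 > ω₁`, every countably tight regular ωD-bounded space is ω-bounded. -/
theorem stmt5 (hb : Cardinal.aleph 1 < boundingNumber)
    {X : Type} [TopologicalSpace X] [T1Space X] [RegularSpace X]
    (htight : ∀ x : X, CountableTightnessAt x)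
    (hωD : ∀ D : Set X, D.Countable → DiscreteTopology D → IsCompact (closure D)) :
    ∀ A : Set X, A.Countable → IsCompact (closure A) := by
  intro A hA
  rcases A.eq_empty_or_nonempty with rfl | hne
  · simp
  obtain ⟨e, rfl⟩ := hA.exists_eq_range hne
  refine isCompact_of_finite_subcover fun {ι} U hUo hCU => ?_
  by_contra! hno
  have hmono : ∀ W : ℕ → Set X, (∀ n, IsOpen (W n)) → Monotone W →
      closure (range e) ⊆ ⋃ n, W n → ∃ n, closure (range e) ⊆ W n := fun W hWo hWm =>
    exists_subset_of_discrete_compact hωD isClosed_closure hWo hWm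
  choose i hi using fun m => mem_iUnion.mp (hCU (subset_closure (mem_range_self m)))
  choose V hV hVU using fun m => (closed_nhds_basis (e m)).mem_iff.mp ((hUo (i m)).mem_nhds (hi m))
  let W : ℕ → Set X := fun n => ⋃ m ∈ Iic n, interior (V m)
  have hWo : ∀ n, IsOpen (W n) := fun n => isOpen_biUnion fun _ _ => isOpen_interior
  have hWm : Monotone W := fun m n hmn => biUnion_subset_biUnion_left (Iic_subset_Iic.mpr hmn)
  have hWcl : ∀ n, closure (W n) ⊆ ⋃ m, U (i m) := fun n =>
    (closure_minimal (iUnion₂_mono fun m _ => interior_subset)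
      ((finite_Iic n).isClosed_biUnion fun m _ => (hV m).2)).trans
      (iUnion₂_subset fun m _ => (hVU m).trans (subset_iUnion (fun m => U (i m)) m))
  let G : Set X := closure (range e) \ ⋃ m, U (i m)
  have hG : IsClosed G := isClosed_closure.sdiff (isOpen_iUnion fun m => hUo (i m))
  have hGc : IsCompact G := isCompact_of_card_le_aleph_one htight hG fun S hS hcard =>
    isCompact_closure_of_card_le_aleph_one hb htight hωD hWo hWm
      (fun m => ⟨m, mem_iUnion₂.mpr ⟨m, mem_Iic.mpr le_rfl, mem_interior_iff_mem_nhds.mpr (hV m).1⟩⟩)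
      (hS.trans sdiff_subset)
      (fun n => disjoint_left.mpr fun x hx hxS => (hS hxS).2 (hWcl n hx)) hcard
  obtain ⟨t, ht⟩ := hGc.elim_finite_subcover U hUo (sdiff_subset.trans hCU)
  obtain ⟨t', ht'⟩ := exists_finset_cover_of_countable hmono hUo
    (t.countable_toSet.union (countable_range i)) fun x hx => by
      by_cases hxU : x ∈ ⋃ m, U (i m)
      · obtain ⟨m, hm⟩ := mem_iUnion.mp hxU
        exact mem_iUnion₂.mpr ⟨i m, Or.inr ⟨m, rfl⟩, hm⟩
      · obtain ⟨k, hk, hxk⟩ := mem_iUnion₂.mp (ht ⟨hx, hxU⟩)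
        exact mem_iUnion₂.mpr ⟨k, Or.inl hk, hxk⟩
  exact hno t' ht'
end

section
/- Let {X_i : i ∈ I} be a family of Hausdorff spaces whose product X = ∏_{i∈I} X_i is ωD-bounded (every countable discrete subspace of X has compact closure) but not ω-bounded (some countable subset of X fails to have compact closure). Then there exists i ∈ I such that the product ∏_{j ∈ I, j ≠ i} X_j is finite. -/
open Set Topology Filter

/-- A set of representatives of pairwise disjoint open sets is discrete. -/
theorem discreteTopology_range_of_disjoint_isOpen {ι Y : Type*} [TopologicalSpace Y]
    {U : ι → Set Y} (hUo : ∀ n, IsOpen (U n)) (hUd : Pairwise (Function.onFun Disjoint U))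
    {d : ι → Y} (hd : ∀ n, d n ∈ U n) : DiscreteTopology (range d) := by
  rw [discreteTopology_subtype_iff']
  rintro _ ⟨n, rfl⟩
  refine ⟨U n, hUo n, Subset.antisymm ?_ ?_⟩
  · rintro _ ⟨hx, m, rfl⟩
    have hmn : m = n := by
      by_contra hne
      exact disjoint_left.mp (hUd hne) (hd m) hx
    simp [hmn]
  · rintro _ rfl
    exact ⟨hd n, n, rfl⟩

/-- If a product is ωD-bounded and the product of all factors but the `i`-th is an infinite
Hausdorff space, then projections of countable sets to the `i`-th factor lie in compact sets. -/
theorem exists_isCompact_image_eval_subset {I : Type*} (X : I → Type*)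
    [∀ i, TopologicalSpace (X i)] [∀ i, T2Space (X i)]
    (hωD : ∀ D : Set (Π i, X i), D.Countable → DiscreteTopology D → IsCompact (closure D))
    {A : Set (Π i, X i)} (hA : A.Countable) (i : I) [Infinite (Π j : {j : I // j ≠ i}, X j)] :
    ∃ K : Set (X i), IsCompact K ∧ Function.eval i '' A ⊆ K := by
  classical
  rcases A.eq_empty_or_nonempty with rfl | hne
  · exact ⟨∅, isCompact_empty, by simp⟩
  obtain ⟨a, rfl⟩ := hA.exists_eq_range hne
  obtain ⟨U, hU, hUo, hUd⟩ :=
    exists_seq_infinite_isOpen_pairwise_disjoint (Π j : {j : I // j ≠ i}, X j)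
  choose z hz using fun n => (hU n).nonempty
  let d : ℕ → Π j, X j := fun n j => if h : j = i then a n j else z n ⟨j, h⟩
  let r : (Π j, X j) → Π j : {j : I // j ≠ i}, X j := fun x j => x j
  have hr : Continuous r := by fun_prop
  have hrd : ∀ n, r (d n) = z n := fun n => funext fun j => dif_neg j.2
  have hdisc : DiscreteTopology (range d) :=
    discreteTopology_range_of_disjoint_isOpen (U := fun n => r ⁻¹' U n)
      (fun n => (hUo n).preimage hr) (fun _ _ hmn => (hUd hmn).preimage r)
      (fun n => by simpa [hrd] using hz n)
  refine ⟨_, (hωD _ (countable_range d) hdisc).image (continuous_apply i), ?_⟩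
  rintro _ ⟨_, ⟨n, rfl⟩, rfl⟩
  exact ⟨d n, subset_closure ⟨n, rfl⟩, dif_pos rfl⟩

/-- If a product of Hausdorff spaces is ωD-bounded but not ω-bounded, then all but one
of the factors forms a finite product. -/
theorem stmt6 {I : Type*} (X : I → Type*) [∀ i, TopologicalSpace (X i)] [∀ i, T2Space (X i)]
    (hωD : ∀ D : Set (Π i, X i), D.Countable → DiscreteTopology D → IsCompact (closure D))
    (hnotω : ∃ A : Set (Π i, X i), A.Countable ∧ ¬ IsCompact (closure A)) :
    ∃ i : I, Finite (Π j : {j : I // j ≠ i}, X j) := by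
  by_contra! hinf
  obtain ⟨A, hA, hAc⟩ := hnotω
  choose K hK hAK using fun i =>
    have : Infinite (Π j : {j : I // j ≠ i}, X j) := by simpa using hinf i
    exists_isCompact_image_eval_subset X hωD hA i
  exact hAc <| (isCompact_univ_pi hK).closure_of_subset
    fun x hx i _ => hAK i ⟨x, hx, rfl⟩
end

section
/- If X is a weakly bounded topological space and Y is a countably compact topological space, then the product X × Y is countably compact. -/
open Set Topology Filter

/-- A space is weakly bounded iff every infinite subset has an infinite subset with
compact closure. -/
def WeaklyBounded (X : Type*) [TopologicalSpace X] : Prop :=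
  ∀ A : Set X, A.Infinite → ∃ B ⊆ A, B.Infinite ∧ IsCompact (closure B)

/-- An increasing sequence of open sets covering a countably compact space is eventually
the whole space. -/
theorem CountablyCompactSp.exists_eq_univ_of_monotone {Y : Type*} [TopologicalSpace Y]
    (hY : CountablyCompactSp Y) {V : ℕ → Set Y} (hV : Monotone V) (ho : ∀ n, IsOpen (V n))
    (hc : ⋃ n, V n = univ) : ∃ n, V n = univ := by
  obtain ⟨𝒱, hsub, hfin, hcov⟩ := hY (range V) (countable_range V)
    (forall_mem_range.2 ho) (by rwa [sUnion_range])
  obtain ⟨t, rfl⟩ := subset_range_iff_exists_image_eq.1 hsub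
  obtain ⟨s, -, hs⟩ := exists_subset_bijOn t V
  obtain ⟨n, hn⟩ := (hs.finite_iff_finite.2 hfin).bddAbove
  refine ⟨n, univ_subset_iff.1 ?_⟩
  rw [← hcov, ← hs.image_eq, sUnion_image]
  exact iUnion₂_subset fun i hi => hV (hn hi)

/-- If every increasing sequence of open sets covering `X` contains the whole space, then `X`
is countably compact. -/
theorem CountablyCompactSp.of_forall_monotone {X : Type*} [TopologicalSpace X]
    (h : ∀ W : ℕ → Set X, Monotone W → (∀ n, IsOpen (W n)) → ⋃ n, W n = univ →
      ∃ n, W n = univ) : CountablyCompactSp X := by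
  intro 𝒰 hcount hopen hcov
  rcases 𝒰.eq_empty_or_nonempty with rfl | hne
  · exact ⟨∅, Subset.rfl, finite_empty, hcov⟩
  obtain ⟨u, rfl⟩ := hcount.exists_eq_range hne
  obtain ⟨n, hn⟩ := h (accumulate u) monotone_accumulate
    (fun n => isOpen_biUnion fun i _ => hopen _ (mem_range_self i))
    (by rw [iUnion_accumulate, ← sUnion_range, hcov])
  exact ⟨u '' Iic n, image_subset_range _ _, (finite_Iic n).image u, by
    rw [sUnion_image]; exact hn⟩

/-- Every sequence in a weakly bounded space visits some compact set infinitely often. -/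
theorem WeaklyBounded.exists_isCompact_infinite {X : Type*} [TopologicalSpace X]
    (hX : WeaklyBounded X) (x : ℕ → X) :
    ∃ K : Set X, IsCompact K ∧ {n | x n ∈ K}.Infinite := by
  by_cases hfin : (range x).Finite
  · exact ⟨range x, hfin.isCompact, by simpa using infinite_univ⟩
  · obtain ⟨B, hB, hinf, hK⟩ := hX (range x) hfin
    exact ⟨closure B, hK, (hinf.preimage hB).mono fun n hn => subset_closure hn⟩

/-- An increasing open cover of `X × Y` with `Y` countably compact has a member containing
`K ×ˢ univ`, for each compact `K`. -/
theorem IsCompact.exists_prod_univ_subset {X Y : Type*} [TopologicalSpace X]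
    [TopologicalSpace Y] {K : Set X} (hK : IsCompact K) (hY : CountablyCompactSp Y)
    {W : ℕ → Set (X × Y)} (hW : Monotone W) (ho : ∀ n, IsOpen (W n))
    (hc : ⋃ n, W n = univ) : ∃ n, K ×ˢ univ ⊆ W n := by
  obtain ⟨n, hn⟩ := hY.exists_eq_univ_of_monotone (V := fun n => {y | ∀ x ∈ K, (x, y) ∈ W n})
    (fun m n hmn y hy x hx => hW hmn (hy x hx))
    (fun n => isOpen_iff_mem_nhds.2 fun y hy =>
      hK.eventually_forall_of_forall_eventually fun x hx =>
        (continuous_swap.tendsto (y, x)).eventually ((ho n).mem_nhds (hy x hx)))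
    (eq_univ_of_forall fun y => by
      obtain ⟨n, hn⟩ := hK.elim_directed_cover (fun n => (fun x => (x, y)) ⁻¹' W n)
        (fun n => (ho n).preimage (by fun_prop))
        (by rw [← preimage_iUnion, hc]; exact subset_univ _)
        (Monotone.directed_le fun m n hmn => preimage_mono (hW hmn))
      exact mem_iUnion.2 ⟨n, fun x hx => hn hx⟩)
  exact ⟨n, fun p hp => (hn.symm ▸ mem_univ p.2 : p.2 ∈ {y | ∀ x ∈ K, (x, y) ∈ W n}) p.1 hp.1⟩

/-- The product of a weakly bounded space and a countably compact space is countably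
compact. -/
theorem stmt7 {X Y : Type*} [TopologicalSpace X] [TopologicalSpace Y]
    (hX : WeaklyBounded X) (hY : CountablyCompactSp Y) :
    CountablyCompactSp (X × Y) := by
  refine .of_forall_monotone fun W hW ho hc => ?_
  by_contra! hne
  choose p hp using fun n => (ne_univ_iff_exists_notMem _).1 (hne n)
  obtain ⟨K, hK, hinf⟩ := hX.exists_isCompact_infinite fun n => (p n).1
  obtain ⟨n, hn⟩ := hK.exists_prod_univ_subset hY hW ho hc
  obtain ⟨m, hm, hnm⟩ := hinf.exists_gt n
  exact hp m (hW hnm.le (hn ⟨hm, mem_univ _⟩))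
end

section
/- Let {X_α : α < 𝔱} be a family of weakly bounded topological spaces indexed by the tower number 𝔱. Then the product ∏_{α<𝔱} X_α is countably compact. -/
open Set Topology Filter Cardinal

/-- The tower number `𝔱`: the least cardinality of a family of infinite subsets of `ℕ`,
linearly ordered by `⊆*` (almost inclusion), that has no pseudo-intersection. -/
noncomputable def towerNumber : Cardinal :=
  sInf {c : Cardinal | ∃ T : Set (Set ℕ), #(↥T) = c ∧ (∀ A ∈ T, A.Infinite) ∧
    (∀ A ∈ T, ∀ B ∈ T, (A \ B).Finite ∨ (B \ A).Finite) ∧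
    ¬ ∃ C : Set ℕ, C.Infinite ∧ ∀ A ∈ T, (C \ A).Finite}

/-- Fewer than `𝔱` many infinite sets, linearly ordered by almost inclusion, have a
pseudo-intersection. -/
lemma exists_pseudoIntersection_of_mk_lt {T : Set (Set ℕ)} (hT : #(↥T) < towerNumber)
    (hinf : ∀ A ∈ T, A.Infinite)
    (hlin : ∀ A ∈ T, ∀ B ∈ T, (A \ B).Finite ∨ (B \ A).Finite) :
    ∃ C : Set ℕ, C.Infinite ∧ ∀ A ∈ T, (C \ A).Finite := by
  by_contra h
  exact notMem_of_lt_csInf' hT ⟨T, rfl, hinf, hlin, h⟩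

/-- If every infinite set of naturals can be shrunk to meet each of the requirements `P i`, then
the requirements can be met along a `⊆*`-decreasing family, provided that initial segments of
the index set have fewer than `𝔱` elements. -/
lemma exists_almostDecreasing {ι : Type} [LinearOrder ι] [WellFoundedLT ι]
    (hcard : ∀ i : ι, #(↥(Iio i)) < towerNumber) (P : ι → Set ℕ → Prop)
    (hP : ∀ i (C : Set ℕ), C.Infinite → ∃ D ⊆ C, D.Infinite ∧ P i D) :
    ∃ T : ι → Set ℕ, ∀ i, (T i).Infinite ∧ P i (T i) ∧ ∀ j < i, (T i \ T j).Finite := by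
  classical
  let Q : (i : ι) → ((j : ι) → j < i → Set ℕ) → Set ℕ → Prop := fun i f D =>
    D.Infinite ∧ P i D ∧ ∀ j (hj : j < i), (D \ f j hj).Finite
  let F : (i : ι) → ((j : ι) → j < i → Set ℕ) → Set ℕ := fun i f =>
    if h : ∃ D, Q i f D then h.choose else univ
  let T : ι → Set ℕ := (wellFounded_lt (α := ι)).fix F
  have hT : ∀ i, T i = F i fun j _ => T j := fun i => WellFounded.fix_eq _ F i
  refine ⟨T, fun i => ?_⟩
  induction i using WellFoundedLT.induction with
  | ind i ih =>
    obtain ⟨C, hC, hCT⟩ := exists_pseudoIntersection_of_mk_lt (T := T '' Iio i)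
      (mk_image_le.trans_lt (hcard i))
      (by rintro _ ⟨j, hj, rfl⟩; exact (ih j hj).1)
      (by
        rintro _ ⟨j, hj, rfl⟩ _ ⟨k, hk, rfl⟩
        rcases lt_trichotomy j k with h | rfl | h
        · exact Or.inr ((ih k hk).2.2 j h)
        · simp
        · exact Or.inl ((ih j hj).2.2 k h))
    obtain ⟨D, hDC, hD, hPD⟩ := hP i C hC
    have h : ∃ D, Q i (fun j _ => T j) D :=
      ⟨D, hD, hPD, fun j hj =>
        (hCT _ (mem_image_of_mem T hj)).subset (sdiff_subset_sdiff_left hDC)⟩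
    have hTi : T i = h.choose := by rw [hT i]; exact dif_pos h
    rw [hTi]
    exact h.choose_spec

/-- Every sequence in a weakly bounded space has a subsequence contained in a compact set. -/
lemma WeaklyBounded.exists_infinite_mapsTo_isCompact {X : Type*} [TopologicalSpace X]
    (hX : WeaklyBounded X) (a : ℕ → X) {C : Set ℕ} (hC : C.Infinite) :
    ∃ D ⊆ C, D.Infinite ∧ ∃ K, IsCompact K ∧ MapsTo a D K := by
  by_cases h : (a '' C).Infinite
  · obtain ⟨B, hBC, hB, hK⟩ := hX _ h
    refine ⟨C ∩ a ⁻¹' B, inter_subset_left, ?_, closure B, hK, fun n hn => subset_closure hn.2⟩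
    refine Infinite.of_image a (hB.mono fun b hb => ?_)
    obtain ⟨n, hn, rfl⟩ := hBC hb
    exact ⟨n, ⟨hn, hb⟩, rfl⟩
  · obtain ⟨y, hy⟩ : ∃ y, (C ∩ a ⁻¹' {y}).Infinite := by
      by_contra! hfib
      refine hC (((not_infinite.mp h).biUnion fun y _ => hfib y).subset
        fun n hn => ?_)
      exact mem_biUnion (mem_image_of_mem a hn) ⟨hn, rfl⟩
    exact ⟨C ∩ a ⁻¹' {y}, inter_subset_left, hy, {y}, isCompact_singleton, fun n hn => hn.2⟩

/-- An almost decreasing family of infinite sets is contained in a nonprincipal ultrafilter. -/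
lemma exists_ultrafilter_of_almostDecreasing {ι : Type*} [LinearOrder ι] {T : ι → Set ℕ}
    (hinf : ∀ i, (T i).Infinite) (hT : ∀ i, ∀ j < i, (T i \ T j).Finite) :
    ∃ p : Ultrafilter ℕ, ↑p ≤ (cofinite : Filter ℕ) ∧ ∀ i, T i ∈ p := by
  rcases isEmpty_or_nonempty ι with h | h
  · exact ⟨Ultrafilter.of cofinite, Ultrafilter.of_le _, fun i => h.elim i⟩
  have hanti : Antitone fun i => (cofinite ⊓ 𝓟 (T i) : Filter ℕ) := by
    intro j i hji
    refine le_inf inf_le_left (le_principal_iff.mpr ?_)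
    rcases hji.eq_or_lt with rfl | hlt
    · exact mem_inf_of_right (mem_principal_self _)
    · refine mem_inf_principal.mpr (mem_cofinite.mpr ((hT i j hlt).subset fun n hn => ?_))
      simpa using hn
  have : ∀ i, (cofinite ⊓ 𝓟 (T i) : Filter ℕ).NeBot := fun i =>
    cofinite_inf_principal_neBot_iff.mpr (hinf i)
  have := iInf_neBot_of_directed' hanti.directed_ge this
  have hle := Ultrafilter.of_le (⨅ i, (cofinite ⊓ 𝓟 (T i) : Filter ℕ))
  refine ⟨Ultrafilter.of _, hle.trans ((iInf_le _ h.some).trans inf_le_left), fun i => ?_⟩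
  exact le_principal_iff.mp (hle.trans ((iInf_le _ i).trans inf_le_right))

/-- The limit of an injective sequence along a nonprincipal ultrafilter is an accumulation
point of any set containing the sequence. -/
lemma mem_closure_diff_singleton_of_tendsto {X : Type*} [TopologicalSpace X] {A : Set X}
    {a : ℕ → X} (ha : a.Injective) (haA : ∀ n, a n ∈ A) {l : Filter ℕ} [l.NeBot]
    (hl : l ≤ cofinite) {x : X} (hx : Tendsto a l (𝓝 x)) : x ∈ closure (A \ {x}) := by
  refine mem_closure_of_tendsto hx (hl ?_)
  refine mem_cofinite.mpr (Set.Subsingleton.finite fun m hm n hn => ha ?_)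
  have key : ∀ k ∈ {n | a n ∈ A \ {x}}ᶜ, a k = x := fun k hk => by
    by_contra h
    exact hk ⟨haA k, h⟩
  rw [key m hm, key n hn]

/-- Any product of `𝔱` many weakly bounded spaces is countably compact: every infinite
subset of the product has an accumulation point. -/
theorem stmt9 {ι : Type} (X : ι → Type*) [∀ i, TopologicalSpace (X i)]
    (hcard : #ι = towerNumber) (hwb : ∀ i, WeaklyBounded (X i)) :
    ∀ A : Set (Π i, X i), A.Infinite → ∃ x : Π i, X i, x ∈ closure (A \ {x}) := by
  intro A hA
  obtain ⟨_, _, hord⟩ := Cardinal.exists_ord_eq_type_lt ι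
  have hseg : ∀ i : ι, #(↥(Iio i)) < towerNumber := fun i => hcard ▸ Cardinal.mk_Iio_lt i hord
  let a : ℕ → Π i, X i := fun n => hA.natEmbedding A n
  have ha : a.Injective := fun m n h => (hA.natEmbedding A).injective (Subtype.ext h)
  obtain ⟨T, hT⟩ := exists_almostDecreasing hseg
    (fun i D => ∃ K, IsCompact K ∧ MapsTo (fun n => a n i) D K)
    (fun i C hC => (hwb i).exists_infinite_mapsTo_isCompact _ hC)
  obtain ⟨p, hp, hTp⟩ := exists_ultrafilter_of_almostDecreasing (fun i => (hT i).1)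
    (fun i => (hT i).2.2)
  have hlim : ∀ i, ∃ y, Tendsto (fun n => a n i) p (𝓝 y) := fun i => by
    obtain ⟨K, hK, hmaps⟩ := (hT i).2.1
    obtain ⟨y, -, hy⟩ := hK.ultrafilter_le_nhds (p.map fun n => a n i)
      (tendsto_principal.mpr (mem_of_superset (hTp i) fun _ hn => hmaps hn))
    exact ⟨y, hy⟩
  choose x hx using hlim
  exact ⟨x, mem_closure_diff_singleton_of_tendsto ha (fun n => (hA.natEmbedding A n).2) hp
    (tendsto_pi_nhds.mpr hx)⟩
end

section
/- Let λ be an infinite cardinal such that λ = ν_λ < 𝔠, where ν_λ is the cofinality of the ideal of nowhere dense subsets of the Cantor cube 2^λ. Then the Cantor cube 2^λ has a countable dense subspace S that is nodec, i.e., every nowhere dense subset of S is closed in S. -/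
open Set Topology Filter Cardinal

/-- `ν_λ`: the cofinality of the ideal of nowhere dense subsets of the Cantor cube `2^λ`,
i.e. the least cardinality of a family of nowhere dense sets such that every nowhere dense
set is contained in a member of the family. -/
noncomputable def nwdCofinality (ι : Type*) : Cardinal :=
  sInf {c : Cardinal | ∃ H : Set (Set (ι → Bool)), #(↥H) = c ∧
    (∀ h ∈ H, IsNowhereDense h) ∧
    ∀ s : Set (ι → Bool), IsNowhereDense s → ∃ h ∈ H, s ⊆ h}

section CantorCube

variable {ι : Type*}

lemma isOpen_setOf_forall_mem_finset_eq (s : Finset ι) (t : ι → Bool) :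
    IsOpen {q : ι → Bool | ∀ i ∈ s, q i = t i} := by
  have : {q : ι → Bool | ∀ i ∈ s, q i = t i} = (s : Set ι).pi fun i => {t i} := by
    ext q; simp [Set.mem_pi]
  rw [this]
  exact isOpen_set_pi s.finite_toSet fun i _ => isOpen_discrete _

lemma IsOpen.exists_finset_forall_eq {U : Set (ι → Bool)} (hU : IsOpen U) {p : ι → Bool}
    (hp : p ∈ U) : ∃ s : Finset ι, ∀ q : ι → Bool, (∀ i ∈ s, q i = p i) → q ∈ U := by
  obtain ⟨s, u, hu, hsub⟩ := isOpen_pi_iff.1 hU p hp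
  refine ⟨s, fun q hq => hsub fun i hi => ?_⟩
  rw [hq i hi]
  exact (hu i hi).2

/-- A sequence in the Cantor cube visiting every basic clopen set infinitely often. -/
def FrequentlyVisits (d : ℕ → ι → Bool) : Prop :=
  ∀ (s : Finset ι) (t : ι → Bool), {n | ∀ i ∈ s, d n i = t i}.Infinite

lemma FrequentlyVisits.denseRange {d : ℕ → ι → Bool} (hd : FrequentlyVisits d) :
    DenseRange d := by
  refine dense_iff_inter_open.2 fun U hU ⟨p, hp⟩ => ?_
  obtain ⟨s, hs⟩ := hU.exists_finset_forall_eq hp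
  obtain ⟨n, hn⟩ := (hd s p).nonempty
  exact ⟨d n, hs _ hn, n, rfl⟩

/-- The Cantor cube `2^κ` is separable for `κ ≤ 𝔠`. -/
lemma exists_frequentlyVisits_of_injective {e : ι → ℕ → Bool} (he : Function.Injective e) :
    ∃ d : ℕ → ι → Bool, FrequentlyVisits d := by
  classical
  let C := Σ n : ℕ, Finset (Fin n → Bool)
  have : Nonempty C := ⟨⟨0, ∅⟩⟩
  obtain ⟨g, hg⟩ := exists_surjective_nat C
  let D : C → ι → Bool := fun c i => decide ((fun k : Fin c.1 => e i k) ∈ c.2)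
  have hD : ∀ (s : Finset ι) (t : ι → Bool), ∃ c, ∀ i ∈ s, D c i = t i := by
    intro s t
    have hsep : ∀ i j : ι, ∃ k, i ≠ j → e i k ≠ e j k := by
      intro i j
      by_cases h : i = j
      · exact ⟨0, fun h' => (h' h).elim⟩
      · obtain ⟨k, hk⟩ := Function.ne_iff.1 (he.ne h)
        exact ⟨k, fun _ => hk⟩
    choose k hk using hsep
    let N : ℕ := (s ×ˢ s).sup (fun p => k p.1 p.2 + 1)
    refine ⟨⟨N, (s.filter fun i => t i = true).image fun i (l : Fin N) => e i l⟩, ?_⟩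
    intro i hi
    rw [Bool.eq_iff_iff]
    simp only [D, decide_eq_true_eq, Finset.mem_image, Finset.mem_filter]
    constructor
    · rintro ⟨j, ⟨hj, htj⟩, hji⟩
      by_cases h : j = i
      · exact h ▸ htj
      · have hlt : k j i < N := Nat.lt_of_succ_le
          (Finset.le_sup (f := fun p : ι × ι => k p.1 p.2 + 1)
            (Finset.mk_mem_product hj hi))
        exact (hk j i h (congrFun hji ⟨k j i, hlt⟩)).elim
    · exact fun h => ⟨i, ⟨hi, h⟩, rfl⟩
  refine ⟨fun n => D (g n.unpair.1), fun s t => ?_⟩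
  obtain ⟨c, hc⟩ := hD s t
  obtain ⟨a, rfl⟩ := hg c
  refine Set.infinite_of_injective_forall_mem (f := fun b : ℕ => Nat.pair a b) ?_ ?_
  · intro b b' h
    exact (Nat.pair_eq_pair.1 h).2
  · intro b
    simpa using hc

/-- In a separable Cantor cube, every nowhere dense set is contained in a closed nowhere dense
set depending on countably many coordinates only. -/
lemma IsNowhereDense.exists_countable_support {d : ℕ → ι → Bool} (hd : DenseRange d)
    {T : Set (ι → Bool)} (hT : IsNowhereDense T) :
    ∃ (A : Set (ι → Bool)) (c : Set ι), T ⊆ A ∧ IsClosed A ∧ IsNowhereDense A ∧ c.Countable ∧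
      ∀ x x' : ι → Bool, (∀ i ∈ c, x i = x' i) → x ∈ A → x' ∈ A := by
  obtain ⟨hVo, hVd⟩ := isClosed_isNowhereDense_iff_compl.1 ⟨isClosed_closure, hT.closure⟩
  have hs : ∀ n, ∃ s : Finset ι, d n ∈ (closure T)ᶜ →
      ∀ q : ι → Bool, (∀ i ∈ s, q i = d n i) → q ∈ (closure T)ᶜ := by
    intro n
    by_cases h : d n ∈ (closure T)ᶜ
    · obtain ⟨s, hs⟩ := hVo.exists_finset_forall_eq h
      exact ⟨s, fun _ => hs⟩
    · exact ⟨∅, fun h' => (h h').elim⟩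
  choose s hs using hs
  let U : Set (ι → Bool) :=
    ⋃ n ∈ {n | d n ∈ (closure T)ᶜ}, {q | ∀ i ∈ s n, q i = d n i}
  have hUo : IsOpen U := isOpen_biUnion fun n _ => isOpen_setOf_forall_mem_finset_eq _ _
  have hUd : Dense U := by
    refine (hVd.inter_of_isOpen_left hd hVo).mono ?_
    rintro _ ⟨hx, n, rfl⟩
    exact mem_biUnion (show n ∈ {n | d n ∈ (closure T)ᶜ} from hx) fun _ _ => rfl
  obtain ⟨hc, hn⟩ := isClosed_isNowhereDense_iff_compl.2
    (show IsOpen Uᶜᶜ ∧ Dense Uᶜᶜ by rw [compl_compl]; exact ⟨hUo, hUd⟩)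
  refine ⟨Uᶜ, ⋃ n, (s n : Set ι), ?_, hc, hn, countable_iUnion fun n => (s n).countable_toSet, ?_⟩
  · intro x hx hxU
    obtain ⟨n, hn, hxn⟩ := mem_iUnion₂.1 hxU
    exact hs n hn x hxn (subset_closure hx)
  · intro x x' hxx' hx hx'
    obtain ⟨n, hn, hxn⟩ := mem_iUnion₂.1 hx'
    exact hx (mem_biUnion hn fun i hi => (hxx' i (mem_iUnion.2 ⟨n, hi⟩)).trans (hxn i hi))

/-- The transfinite modification of a sequence `d`: at the coordinate `i`, of rank `r i`, the
`m i`-th term becomes `true`, and every other term that lies in `A i`, as witnessed by the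
coordinates of smaller rank, becomes `false`. -/
noncomputable def separatingModification {W : Type*} [LT W] [WellFoundedLT W] (r : ι → W)
    (A : ι → Set (ι → Bool)) (m : ι → ℕ) (d : ℕ → ι → Bool) (n : ℕ) : ι → Bool :=
  (InvImage.wf r (wellFounded_lt (α := W))).fix fun i y => by
    classical
    exact if n = m i then true
      else if (fun j => if h : r j < r i then y j h else false) ∈ A i then false else d n i

lemma separatingModification_apply {W : Type*} [Preorder W] [WellFoundedLT W] {r : ι → W}
    {A : ι → Set (ι → Bool)} {m : ι → ℕ} {d : ℕ → ι → Bool}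
    (hA : ∀ i, ∀ x x' : ι → Bool, (∀ j, r j < r i → x j = x' j) → x ∈ A i → x' ∈ A i)
    (n : ℕ) (i : ι) [Decidable (separatingModification r A m d n ∈ A i)] :
    separatingModification r A m d n i =
      if n = m i then true
      else if separatingModification r A m d n ∈ A i then false else d n i := by
  classical
  have key : (fun j => if r j < r i then separatingModification r A m d n j else false) ∈ A i ↔
      separatingModification r A m d n ∈ A i :=
    ⟨hA i _ _ fun j hj => by simp [hj], hA i _ _ fun j hj => by simp [hj]⟩
  conv_lhs => rw [separatingModification, WellFounded.fix_eq]
  change (if n = m i then true else if (fun j => if h : r j < r i then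
    separatingModification r A m d n j else false) ∈ A i then false else d n i) = _
  simp only [dite_eq_ite, key]

lemma FrequentlyVisits.separatingModification {W : Type*} [LinearOrder W] [WellFoundedLT W]
    {r : ι → W} {A : ι → Set (ι → Bool)} {m : ι → ℕ} {d : ℕ → ι → Bool}
    (hW : ∀ c : Set W, c.Countable → ∃ b, ∀ a ∈ c, a < b)
    (hclosed : ∀ i, IsClosed (A i)) (hnwd : ∀ i, IsNowhereDense (A i))
    (hA : ∀ i, ∀ x x' : ι → Bool, (∀ j, r j < r i → x j = x' j) → x ∈ A i → x' ∈ A i)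
    (hd : FrequentlyVisits d) : FrequentlyVisits (separatingModification r A m d) := by
  classical
  set y := _root_.separatingModification r A m d with hy
  let z : W → ℕ → ι → Bool := fun b n i => if r i < b then y n i else d n i
  have hz : ∀ b, FrequentlyVisits (z b) := by
    intro b
    induction b using WellFoundedLT.induction with
    | ind b ih =>
    intro s t
    by_cases hne : (s.filter fun i => r i < b).Nonempty
    · obtain ⟨i₀, hi₀, hmax⟩ := Finset.exists_max_image _ r hne
      simp only [Finset.mem_filter] at hi₀ hmax
      let F := s.filter fun i => r i = r i₀
      let B : Set (ι → Bool) := ⋃ i ∈ F, A i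
      have hBc : IsClosed B := F.finite_toSet.isClosed_biUnion fun i _ => hclosed i
      have hBd : Dense Bᶜ := by
        have : Bᶜ = ⋂ i ∈ F, (A i)ᶜ := by simp [B]
        rw [this]
        refine dense_biInter_of_isOpen (fun i _ => (hclosed i).isOpen_compl)
          F.countable_toSet fun i _ => ?_
        exact (isClosed_isNowhereDense_iff_compl.1 ⟨hclosed i, hnwd i⟩).2
      obtain ⟨p, hps, hpB⟩ := hBd.inter_open_nonempty _
        (isOpen_setOf_forall_mem_finset_eq s t) ⟨t, fun _ _ => rfl⟩
      obtain ⟨s', hs'⟩ := hBc.isOpen_compl.exists_finset_forall_eq hpB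
      have hinf := (ih (r i₀) hi₀.2 (s ∪ s'.filter fun i => r i < r i₀) p).sdiff
        (F.image m).finite_toSet
      refine hinf.mono ?_
      rintro n ⟨hn, hnm⟩ i hi
      have hout : ∀ j ∈ F, y n ∉ A j := by
        intro j hj hyj
        have hrj : r j = r i₀ := (Finset.mem_filter.1 hj).2
        refine hs' (fun k => if r k < r i₀ then y n k else p k) ?_ (mem_biUnion hj ?_)
        · intro k hk
          by_cases hlt : r k < r i₀
          · simpa [z, hlt] using hn k (by simp [hk, hlt])
          · simp [hlt]
        · exact hA j _ _ (fun k hk => by simp [← hrj, hk]) hyj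
      have hni := hn i (by simp [hi])
      rw [hps i hi] at hni
      rw [← hni]
      by_cases hib : r i < b
      · rcases (hmax i ⟨hi, hib⟩).lt_or_eq with hlt | heq
        · simp [z, hlt, hib]
        · have hiF : i ∈ F := Finset.mem_filter.2 ⟨hi, heq⟩
          have hnmi : n ≠ m i := fun h => hnm (by
            rw [h]; exact Finset.mem_coe.2 (Finset.mem_image_of_mem m hiF))
          have : y n i = d n i := by
            rw [hy, separatingModification_apply hA, if_neg hnmi, if_neg (hout i hiF)]
          simp [z, heq, this]
      · have : ¬ r i < r i₀ := fun h => hib (h.trans hi₀.2)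
        simp [z, hib, this]
    · refine (hd s t).mono fun n hn i hi => ?_
      have : ¬ r i < b := fun h => hne ⟨i, Finset.mem_filter.2 ⟨hi, h⟩⟩
      simpa [z, this] using hn i hi
  intro s t
  obtain ⟨b, hb⟩ := hW (r '' s) (s.countable_toSet.image r)
  refine (hz b s t).mono fun n hn i hi => ?_
  simpa [z, hb _ (mem_image_of_mem r hi)] using hn i hi

lemma exists_countable_dense_nodec {W : Type*} [LinearOrder W] [WellFoundedLT W]
    {r : ι → W} {A : ι → Set (ι → Bool)} {m : ι → ℕ} {d : ℕ → ι → Bool}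
    (hW : ∀ c : Set W, c.Countable → ∃ b, ∀ a ∈ c, a < b)
    (hclosed : ∀ i, IsClosed (A i)) (hnwd : ∀ i, IsNowhereDense (A i))
    (hA : ∀ i, ∀ x x' : ι → Bool, (∀ j, r j < r i → x j = x' j) → x ∈ A i → x' ∈ A i)
    (hcof : ∀ T : Set (ι → Bool), IsNowhereDense T → ∀ n, ∃ i, m i = n ∧ T ⊆ A i)
    (hd : FrequentlyVisits d) :
    ∃ S : Set (ι → Bool), S.Countable ∧ Dense S ∧
      ∀ T : Set ↥S, IsNowhereDense T → IsClosed T := by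
  classical
  let y := separatingModification r A m d
  refine ⟨range y, countable_range y,
    (hd.separatingModification hW hclosed hnwd hA).denseRange, fun T hT => ?_⟩
  rw [← isOpen_compl_iff, isOpen_iff_forall_mem_open]
  rintro ⟨_, n, rfl⟩ hx
  obtain ⟨i, rfl, hTi⟩ := hcof _ hT.image_val n
  refine ⟨{x | x.1 i = true}, ?_, ?_, ?_⟩
  · rintro ⟨_, k, rfl⟩ hk hkT
    have hkA : y k ∈ A i := hTi ⟨_, hkT, rfl⟩
    have hki : k ≠ m i := by
      rintro rfl
      exact hx hkT
    have : y k i = false := by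
      simp only [y] at hkA ⊢
      rw [separatingModification_apply hA, if_neg hki, if_pos hkA]
    simp [this] at hk
  · exact (isOpen_discrete {true}).preimage
      ((continuous_apply (A := fun _ : ι => Bool) i).comp continuous_subtype_val)
  · change y (m i) i = true
    simp only [y]
    rw [separatingModification_apply hA, if_pos rfl]

lemma exists_indexed_cofinal_nowhereDense (h : #ι = nwdCofinality ι) :
    ∃ H : ι → Set (ι → Bool), (∀ i, IsNowhereDense (H i)) ∧
      ∀ s : Set (ι → Bool), IsNowhereDense s → ∃ i, s ⊆ H i := by
  obtain ⟨H, hcard, hH, hcof⟩ : #ι ∈ {c : Cardinal | ∃ H : Set (Set (ι → Bool)), #(↥H) = c ∧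
      (∀ h ∈ H, IsNowhereDense h) ∧
      ∀ s : Set (ι → Bool), IsNowhereDense s → ∃ h ∈ H, s ⊆ h} := by
    rw [h]
    exact csInf_mem ⟨_, {s | IsNowhereDense s}, rfl, fun _ h => h, fun s hs => ⟨s, hs, subset_rfl⟩⟩
  obtain ⟨e⟩ := Cardinal.eq.1 hcard.symm
  refine ⟨fun i => (e i).1, fun i => hH _ (e i).2, fun s hs => ?_⟩
  obtain ⟨t, ht, hst⟩ := hcof s hs
  exact ⟨e.symm ⟨t, ht⟩, by simpa using hst⟩

lemma isNowhereDense_singleton_cantorCube [Infinite ι] (p : ι → Bool) :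
    IsNowhereDense ({p} : Set (ι → Bool)) := by
  rw [isClosed_singleton.isNowhereDense_iff, eq_empty_iff_forall_notMem]
  intro q hq
  obtain ⟨s, hs⟩ := isOpen_interior.exists_finset_forall_eq hq
  classical
  obtain ⟨i, hi⟩ := Infinite.exists_notMem_finset s
  have h1 : q = p := mem_singleton_iff.1 (interior_subset hq)
  have h2 : Function.update q i (!q i) = p :=
    mem_singleton_iff.1 <| interior_subset <| hs _ fun j hj =>
      Function.update_of_ne (by rintro rfl; exact hi hj) _ _
  have := congrFun (h2.trans h1.symm) i
  simp at this

lemma uncountable_of_cofinal_nowhereDense [Infinite ι] {κ : Type*} {H : κ → Set (ι → Bool)}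
    (hH : ∀ i, IsNowhereDense (H i))
    (hcof : ∀ s : Set (ι → Bool), IsNowhereDense s → ∃ i, s ⊆ H i) : Uncountable κ := by
  by_contra hc
  rw [not_uncountable_iff] at hc
  have hd : Dense (⋂ i, (closure (H i))ᶜ) := dense_iInter_of_isOpen
    (fun i => isClosed_closure.isOpen_compl)
    fun i => (isClosed_isNowhereDense_iff_compl.1 ⟨isClosed_closure, (hH i).closure⟩).2
  obtain ⟨p, hp⟩ := hd.nonempty
  obtain ⟨i, hi⟩ := hcof _ (isNowhereDense_singleton_cantorCube p)
  exact mem_iInter.1 hp i (subset_closure (hi rfl))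

end CantorCube

lemma exists_forall_lt_of_countable_omega_one (c : Set (Ordinal.omega 1).ToType)
    (hc : c.Countable) : ∃ b, ∀ a ∈ c, a < b := by
  have := hc.to_subtype
  have hlt : (⨆ a : c, Order.succ (Ordinal.ToType.toOrd a.1).1) < Ordinal.omega 1 :=
    Ordinal.iSup_lt_omega_one fun a =>
      (Cardinal.isSuccLimit_omega 1).succ_lt (Ordinal.ToType.toOrd a.1).2
  refine ⟨Ordinal.ToType.mk ⟨_, hlt⟩, fun a ha => ?_⟩
  rw [← Ordinal.ToType.mk.symm_apply_lt, ← Subtype.coe_lt_coe]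
  exact (Order.lt_succ _).trans_le
    (Ordinal.le_iSup (fun a : c => Order.succ (Ordinal.ToType.toOrd a.1).1) ⟨a, ha⟩)

/-- If `λ = ν_λ < 𝔠` then the Cantor cube `2^λ` has a countable dense nodec subspace:
a countable dense set `S` such that every subset of `S` nowhere dense in the subspace `S`
is closed in `S`. -/
theorem stmt10 {ι : Type*} [Infinite ι]
    (h1 : #ι = nwdCofinality ι) (h2 : #ι < Cardinal.continuum) :
    ∃ S : Set (ι → Bool), S.Countable ∧ Dense S ∧
      ∀ T : Set ↥S, IsNowhereDense T → IsClosed T := by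
  classical
  obtain ⟨H, hH, hcof⟩ := exists_indexed_cofinal_nowhereDense h1
  have hunc : Uncountable ι := uncountable_of_cofinal_nowhereDense hH hcof
  obtain ⟨f⟩ : Nonempty (ι ↪ (ℕ → Bool)) := by
    rw [← Cardinal.lift_mk_le']
    simpa using h2.le
  obtain ⟨d, hd⟩ := exists_frequentlyVisits_of_injective f.injective
  choose K c hHK hKc hKn hc hKdep using fun i => (hH i).exists_countable_support hd.denseRange
  obtain ⟨e⟩ : Nonempty (ι ≃ (Ordinal.omega.{0} 1).ToType × ι × ℕ) := by
    rw [← Cardinal.lift_mk_eq']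
    simpa using (Cardinal.mul_eq_right (Cardinal.aleph0_le_mk ι)
      (Cardinal.aleph_one_le_iff.2 Cardinal.aleph0_lt_mk)
      (Cardinal.aleph_pos 1).ne').symm
  let r : ι → (Ordinal.omega.{0} 1).ToType := fun i => (e i).1
  let A : ι → Set (ι → Bool) := fun i =>
    if ∀ j ∈ c (e i).2.1, r j < r i then K (e i).2.1 else ∅
  refine exists_countable_dense_nodec (r := r) (A := A) (m := fun i => (e i).2.2)
    exists_forall_lt_of_countable_omega_one ?_ ?_ ?_ ?_ hd
  · intro i
    by_cases h : ∀ j ∈ c (e i).2.1, r j < r i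
    · simpa only [A, if_pos h] using hKc _
    · simp only [A, if_neg h, isClosed_empty]
  · intro i
    by_cases h : ∀ j ∈ c (e i).2.1, r j < r i
    · simpa only [A, if_pos h] using hKn _
    · simp only [A, if_neg h, isNowhereDense_empty]
  · intro i x x' hx
    by_cases h : ∀ j ∈ c (e i).2.1, r j < r i
    · simpa only [A, if_pos h] using hKdep _ x x' fun j hj => hx j (h j hj)
    · simp only [A, if_neg h, mem_empty_iff_false, false_imp_iff]
  · intro T hT n
    obtain ⟨k, hk⟩ := hcof T hT
    obtain ⟨b, hb⟩ := exists_forall_lt_of_countable_omega_one (r '' c k) ((hc k).image r)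
    refine ⟨e.symm (b, k, n), by simp, ?_⟩
    have h : ∀ j ∈ c (e (e.symm (b, k, n))).2.1, r j < r (e.symm (b, k, n)) := by
      intro j hj
      simp only [Equiv.apply_symm_apply] at hj
      simpa [r] using hb _ (mem_image_of_mem r hj)
    simp only [A, if_pos h]
    simpa using hk.trans (hHK k)
end

section
/- Let X be a regular T1 space and Y ⊆ X. For every countable nowhere dense subset H of X with H ⊆ cl^{ωN}_X(Y), there exists a countable nowhere dense subset K of Y (nowhere dense as a subset of X) such that H is contained in the closure of K in X. -/
open Set Topology Filter

/-- `cl^{ωN}_X(Y)`: the union of the closures of all countable subsets of `Y` that are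
nowhere dense in `X`. -/
def clOmegaN {X : Type*} [TopologicalSpace X] (Y : Set X) : Set X :=
  ⋃ A ∈ {A : Set X | A ⊆ Y ∧ A.Countable ∧ IsNowhereDense A}, closure A

theorem IsNowhereDense.union {X : Type*} [TopologicalSpace X] {s t : Set X}
    (hs : IsNowhereDense s) (ht : IsNowhereDense t) : IsNowhereDense (s ∪ t) := by
  rw [IsNowhereDense, closure_union,
    interior_union_isClosed_of_interior_empty isClosed_closure ht]
  exact hs

theorem Set.Finite.isNowhereDense_biUnion {X ι : Type*} [TopologicalSpace X] {I : Set ι}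
    (hI : I.Finite) {s : ι → Set X} (hs : ∀ i ∈ I, IsNowhereDense (s i)) :
    IsNowhereDense (⋃ i ∈ I, s i) := by
  induction I, hI using Set.Finite.induction_on with
  | empty => simp
  | insert _ _ ih =>
    rw [biUnion_insert]
    exact (hs _ (mem_insert _ _)).union (ih fun i hi => hs i (mem_insert_of_mem _ hi))

/-- A set is nowhere dense if it is locally nowhere dense at each of its points outside the
closure of some nowhere dense set. -/
theorem IsNowhereDense.of_locally_off_closure {X : Type*} [TopologicalSpace X] {N K : Set X}
    (hN : IsNowhereDense N)
    (hK : ∀ x ∈ K, x ∉ closure N → ∃ W ∈ 𝓝 x, IsNowhereDense (K ∩ W)) :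
    IsNowhereDense K := by
  by_contra hne
  have hV : (interior (closure K)).Nonempty := nonempty_iff_ne_empty.mpr hne
  obtain ⟨y, hyV, hyN⟩ := (interior_eq_empty_iff_dense_compl.mp hN).inter_open_nonempty _
    isOpen_interior hV
  obtain ⟨x, ⟨hxV, hxN⟩, hxK⟩ := mem_closure_iff.mp (interior_subset hyV) _
    (isOpen_interior.inter isClosed_closure.isOpen_compl) ⟨hyV, hyN⟩
  obtain ⟨W, hW, hKW⟩ := hK x hxK hxN
  have hsub : closure K ∩ interior W ⊆ closure (K ∩ W) :=
    isOpen_interior.closure_inter.trans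
      (closure_mono (inter_subset_inter_right K interior_subset))
  have hmem : x ∈ interior (closure (K ∩ W)) := by
    rw [mem_interior_iff_mem_nhds]
    exact mem_of_superset (inter_mem (mem_interior_iff_mem_nhds.mp hxV)
      (interior_mem_nhds.mpr hW)) hsub
  rw [hKW] at hmem
  exact hmem

/-- In a regular space, every countable nowhere dense set `H` contained in `cl^{ωN}(Y)`
is contained in the closure of a single countable nowhere dense subset of `Y`. -/
theorem stmt11 {X : Type*} [TopologicalSpace X] [T1Space X] [RegularSpace X]
    (Y : Set X) (H : Set X) (hHcount : H.Countable) (hHnwd : IsNowhereDense H)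
    (hH : H ⊆ clOmegaN Y) :
    ∃ K ⊆ Y, K.Countable ∧ IsNowhereDense K ∧ H ⊆ closure K := by
  have hex : ∀ h ∈ H, ∃ A : Set X, (A ⊆ Y ∧ A.Countable ∧ IsNowhereDense A) ∧ h ∈ closure A := by
    intro h hh
    simpa [clOmegaN] using hH hh
  choose! A hA hmem using hex
  have hS : (⋃ h ∈ H, A h).Countable := hHcount.biUnion fun h hh => (hA h hh).2.1
  obtain ⟨f, hf⟩ := countable_iff_exists_injOn.mp (hS.mono (sdiff_subset (t := closure H)))
  obtain ⟨g, hg⟩ := countable_iff_exists_injOn.mp hHcount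
  set T := (⋃ h ∈ H, A h) \ closure H
  have hW : ∀ x ∈ T, ∃ W ∈ 𝓝 x, IsClosed W ∧ W ⊆ (closure H)ᶜ := fun x hx =>
    exists_mem_nhds_isClosed_subset (isClosed_closure.compl_mem_nhds hx.2)
  choose! W hWx hWc hWH using hW
  let U : X → Set X := fun h => (⋃ x ∈ {x ∈ T | f x ≤ g h}, W x)ᶜ
  have hU : ∀ h, IsOpen (U h) := by
    intro h
    have hfin : {x ∈ T | f x ≤ g h}.Finite :=
      Finite.of_injOn (fun x hx => hx.2) (hf.mono fun x hx => hx.1) (finite_Iic (g h))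
    exact (hfin.isClosed_biUnion fun x hx => hWc x hx.1).isOpen_compl
  have hHU : ∀ h ∈ H, h ∈ U h := by
    intro h hh hmemW
    obtain ⟨x, hx, hxW⟩ := mem_iUnion₂.mp hmemW
    exact hWH x hx.1 hxW (subset_closure hh)
  have hKS : ⋃ h ∈ H, A h ∩ U h ⊆ ⋃ h ∈ H, A h := iUnion₂_mono fun _ _ => inter_subset_left
  refine ⟨⋃ h ∈ H, A h ∩ U h, hKS.trans (iUnion₂_subset fun h hh => (hA h hh).1),
    hS.mono hKS, hHnwd.of_locally_off_closure fun x hx hxH => ?_, fun h hh => ?_⟩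
  · have hxT : x ∈ T := ⟨hKS hx, hxH⟩
    have hfin : {h ∈ H | g h < f x}.Finite :=
      Finite.of_injOn (fun h hh => hh.2) (hg.mono fun h hh => hh.1) (finite_Iio (f x))
    refine ⟨W x, hWx x hxT, IsNowhereDense.mono ?_
      (hfin.isNowhereDense_biUnion fun h hh => (hA h hh.1).2.2)⟩
    rintro z ⟨hz, hzW⟩
    obtain ⟨h, hh, hzA, hzU⟩ := mem_iUnion₂.mp hz
    refine mem_iUnion₂.mpr ⟨h, ⟨hh, ?_⟩, hzA⟩
    by_contra! hle
    exact hzU (mem_iUnion₂.mpr ⟨x, ⟨hxT, hle⟩, hzW⟩)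
  · exact closure_mono (subset_iUnion₂_of_subset h hh Subset.rfl)
      ((hU h).closure_inter ⟨hmem h hh, hHU h hh⟩)
end

section
/- Let X be a regular T1 space in which every point has uncountable character (no point has a countable neighborhood base in X). Then every subspace Y of X that is first countable in its subspace topology is nowhere dense in X. -/
open Set Topology Filter

/-- In a regular space, the closures of the relative neighborhoods of `y` in `Y` generate the
neighborhood filter of `y`, provided `closure Y` is a neighborhood of `y`. -/
theorem lift'_closure_nhdsWithin_eq_nhds {X : Type*} [TopologicalSpace X] [RegularSpace X]
    {Y : Set X} {y : X} (hy : closure Y ∈ 𝓝 y) :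
    (𝓝[Y] y).lift' closure = 𝓝 y := by
  apply le_antisymm
  · calc (𝓝[Y] y).lift' closure ≤ (𝓝 y).lift' closure := lift'_mono nhdsWithin_le_nhds le_rfl
      _ = 𝓝 y := lift'_nhds_closure y
  · refine le_lift'.2 fun s hs => ?_
    obtain ⟨W, hW, hyW, hWs⟩ := mem_nhdsWithin.1 hs
    filter_upwards [hW.mem_nhds hyW, hy] with x hxW hxY
    exact closure_mono hWs (hW.inter_closure ⟨hxW, hxY⟩)

/-- In a regular space in which every point has uncountable character, every first
countable subspace is nowhere dense. -/
theorem stmt13 {X : Type*} [TopologicalSpace X] [T1Space X] [RegularSpace X]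
    (hχ : ∀ x : X, ¬ (𝓝 x).IsCountablyGenerated)
    (Y : Set X) (hY : FirstCountableTopology Y) :
    IsNowhereDense Y := by
  rw [IsNowhereDense, ← not_nonempty_iff_eq_empty]
  rintro ⟨x, hx⟩
  obtain ⟨y, hyU, hyY⟩ := mem_closure_iff.1 (interior_subset hx) _ isOpen_interior hx
  have : (𝓝[Y] y).IsCountablyGenerated := by
    rw [nhdsWithin_eq_map_subtype_coe hyY]
    infer_instance
  obtain ⟨V, hV⟩ := (𝓝[Y] y).exists_antitone_basis
  apply hχ y
  rw [← lift'_closure_nhdsWithin_eq_nhds (mem_interior_iff_mem_nhds.1 hyU)]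
  exact hV.toHasBasis.lift'_closure.isCountablyGenerated
end

section
/- Let X be a regular, countably compact T1 space, S ⊆ X dense, and U a pairwise disjoint family of nonempty open subsets of X. Then the set (closure of ⋃U) \ ⋃{closure of U : U ∈ U} is contained in the closure of ⋃{D' : D ∈ I(S,U)}, where D' denotes the set of accumulation points of D in X. -/
open Set Topology Filter

/-- `I(S,𝒰)`: the collection of countable subsets `D` of `S` meeting each member of `𝒰`
in a finite set. -/
def idealI {X : Type*} [TopologicalSpace X] (S : Set X) (𝒰 : Set (Set X)) : Set (Set X) :=
  {D | D ⊆ S ∧ D.Countable ∧ ∀ U ∈ 𝒰, (D ∩ U).Finite}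

/-- A space all of whose countable open covers have finite subcovers is a
`CountablyCompactSpace`. -/
theorem CountablyCompactSp.countablyCompactSpace {X : Type*} [TopologicalSpace X]
    (h : CountablyCompactSp X) : CountablyCompactSpace X where
  isCountablyCompact_univ := by
    refine isCountablyCompact_iff_countable_open_cover'.2 fun U hU hcover => ?_
    have hfin := h (range U) (countable_range U) (by simpa using hU)
      (by simpa [univ_subset_iff] using hcover)
    rw [← image_univ, exists_subset_image_finite_and (p := fun 𝒱 => ⋃₀ 𝒱 = univ)] at hfin
    obtain ⟨t, -, ht, htU⟩ := hfin
    exact ⟨t, ht, by rw [← sUnion_image, htU]⟩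

/-- A point in the closure of `⋃₀ 𝒰` but in no `closure U` with `U ∈ 𝒰` has only neighborhoods
that meet infinitely many members of `𝒰`. -/
theorem infinite_setOf_inter_nonempty_of_mem_closure_sUnion {X : Type*} [TopologicalSpace X]
    {𝒰 : Set (Set X)} {p : X} (hp : p ∈ closure (⋃₀ 𝒰)) (hp' : ∀ U ∈ 𝒰, p ∉ closure U)
    {V : Set X} (hV : V ∈ 𝓝 p) : {U ∈ 𝒰 | (V ∩ U).Nonempty}.Infinite := by
  intro hfin
  have hmem : p ∈ closure (⋃ U ∈ {U ∈ 𝒰 | (V ∩ U).Nonempty}, U) := by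
    rw [mem_closure_iff_nhds] at hp ⊢
    intro W hW
    obtain ⟨x, ⟨hxW, hxV⟩, U, hU, hxU⟩ := hp (W ∩ V) (inter_mem hW hV)
    exact ⟨x, hxW, mem_biUnion (x := U) ⟨hU, x, hxV, hxU⟩ hxU⟩
  rw [hfin.closure_biUnion] at hmem
  obtain ⟨U, hU, hpU⟩ := mem_iUnion₂.1 hmem
  exact hp' U hU.1 hpU

/-- In a regular countably compact space, `closure (⋃₀ 𝒰) \ ⋃ {closure U : U ∈ 𝒰}` is
contained in the closure of the union of the derived sets of members of `I(S,𝒰)`. -/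
theorem stmt15 {X : Type*} [TopologicalSpace X] [T1Space X] [RegularSpace X]
    (hcc : CountablyCompactSp X) (S : Set X) (hS : Dense S)
    (𝒰 : Set (Set X)) (hdisj : 𝒰.PairwiseDisjoint id)
    (hne : ∀ U ∈ 𝒰, U.Nonempty) (hopen : ∀ U ∈ 𝒰, IsOpen U) :
    closure (⋃₀ 𝒰) \ (⋃ U ∈ 𝒰, closure U) ⊆
      closure (⋃ D ∈ idealI S 𝒰, derivedSet D) := by
  have := hcc.countablyCompactSpace
  rintro p ⟨hp, hp'⟩
  simp only [mem_iUnion, not_exists] at hp'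
  rw [mem_closure_iff_nhds]
  intro O hO
  obtain ⟨C, hC, hCclosed, hCO⟩ := exists_mem_nhds_isClosed_subset hO
  have hinf := infinite_setOf_inter_nonempty_of_mem_closure_sUnion hp hp'
    (interior_mem_nhds.2 hC)
  obtain ⟨e, einj, he⟩ : ∃ e : ℕ → Set X, e.Injective ∧
      ∀ n, e n ∈ {U ∈ 𝒰 | (interior C ∩ U).Nonempty} :=
    ⟨fun n => hinf.natEmbedding _ n,
      Subtype.val_injective.comp (hinf.natEmbedding _).injective,
      fun n => (hinf.natEmbedding _ n).2⟩
  have hpt : ∀ n, ∃ x ∈ S, x ∈ interior C ∩ e n := fun n => by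
    obtain ⟨x, hx, hxS⟩ := hS.inter_open_nonempty _
      (isOpen_interior.inter (hopen _ (he n).1)) (he n).2
    exact ⟨x, hxS, hx⟩
  choose f hfS hf using hpt
  have huniq : ∀ n, ∀ U ∈ 𝒰, f n ∈ U → e n = U := fun n U hU hfU =>
    hdisj.elim_set (he n).1 hU (f n) (hf n).2 hfU
  have finj : f.Injective := fun m n hmn =>
    einj (huniq m _ (he n).1 (hmn ▸ (hf n).2))
  obtain ⟨x, hxC, hx⟩ := hCclosed.isCountablyCompact.exists_accPt_of_infinite
    (range_subset_iff.2 fun n => interior_subset (hf n).1) (infinite_range_of_injective finj)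
  refine ⟨x, hCO hxC, mem_biUnion (x := range f)
    ⟨range_subset_iff.2 hfS, countable_range f, fun U hU => ?_⟩ hx⟩
  refine Set.Subsingleton.finite ?_
  rintro _ ⟨⟨m, rfl⟩, hm⟩ _ ⟨⟨n, rfl⟩, hn⟩
  rw [einj ((huniq m U hU hm).trans (huniq n U hU hn).symm)]
end

section
/- Let X be a regular, countably compact T1 space, S ⊆ X dense, and U a pairwise disjoint family of nonempty open subsets of X. If x ∈ (closure of ⋃U) \ ⋃{closure of U : U ∈ U} and X has countable tightness at x, then there exists D ∈ I(S,U) such that x is an accumulation point of D. -/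
open Set Topology Filter

theorem CountablyCompactSp.isCountablyCompact_univ {X : Type*} [TopologicalSpace X]
    (h : CountablyCompactSp X) : IsCountablyCompact (univ : Set X) := by
  rw [isCountablyCompact_iff_countable_open_cover']
  intro U hUo hU
  have hex := h (range U) (countable_range U)
    (by rintro _ ⟨i, rfl⟩; exact hUo i) (by rw [sUnion_range]; exact univ_subset_iff.1 hU)
  rw [← image_univ, exists_subset_image_finite_and] at hex
  obtain ⟨t, -, ht, hcov⟩ := hex
  exact ⟨t, ht, by rw [← sUnion_image, hcov]⟩

theorem derivedSet_sdiff_of_finite {X : Type*} [TopologicalSpace X] [T1Space X] (D : Set X)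
    {F : Set X} (hF : (D ∩ F).Finite) : derivedSet (D \ F) = derivedSet D := by
  have hempty : derivedSet (D ∩ F) = ∅ :=
    eq_empty_of_forall_notMem fun _ hy => Infinite.of_accPt hy hF
  conv_rhs => rw [← sdiff_union_inter D F, derivedSet_union, hempty, union_empty]

theorem Set.PairwiseDisjoint.countable_of_inter_nonempty {X : Type*} {𝒰 : Set (Set X)}
    (hdisj : 𝒰.PairwiseDisjoint id) {E : Set X} (hE : E.Countable) :
    {U ∈ 𝒰 | (E ∩ U).Nonempty}.Countable := by
  have : {U ∈ 𝒰 | (E ∩ U).Nonempty} ⊆ ⋃ y ∈ E, {U ∈ 𝒰 | y ∈ U} := by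
    rintro U ⟨hU, y, hyE, hyU⟩
    exact mem_biUnion hyE ⟨hU, hyU⟩
  refine (hE.biUnion fun y _ => Set.Subsingleton.countable ?_).mono this
  rintro U ⟨hU, hyU⟩ V ⟨hV, hyV⟩
  exact hdisj.elim_set hU hV y hyU hyV

/-- Countably many members of `I(S,𝒰)` have a pseudo-union in `I(S,𝒰)`. -/
theorem exists_mem_idealI_derivedSet_subset {X : Type*} [TopologicalSpace X] [T1Space X]
    {S : Set X} {𝒰 : Set (Set X)} (hdisj : 𝒰.PairwiseDisjoint id) {D : ℕ → Set X}
    (hD : ∀ n, D n ∈ idealI S 𝒰) :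
    ∃ E ∈ idealI S 𝒰, ∀ n, derivedSet (D n) ⊆ derivedSet E := by
  have hcount : (⋃ n, D n).Countable := countable_iUnion fun n => (hD n).2.1
  obtain ⟨g, hg⟩ := ((hdisj.countable_of_inter_nonempty hcount).insert ∅).exists_eq_range
    (insert_nonempty _ _)
  have hfin : ∀ n i, (D n ∩ g i).Finite := by
    intro n i
    rcases hg ▸ mem_range_self i with h | h
    · simp [h]
    · exact (hD n).2.2 _ h.1
  have hsub : (⋃ n, D n \ ⋃ i ∈ Iio n, g i) ⊆ ⋃ n, D n := iUnion_mono fun n => sdiff_subset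
  refine ⟨⋃ n, D n \ ⋃ i ∈ Iio n, g i,
    ⟨hsub.trans (iUnion_subset fun n => (hD n).1), hcount.mono hsub, fun U hU => ?_⟩,
    fun n => ?_⟩
  · by_cases hne : ((⋃ n, D n) ∩ U).Nonempty
    · obtain ⟨k, rfl⟩ : U ∈ range g := hg ▸ mem_insert_of_mem _ ⟨hU, hne⟩
      refine ((finite_Iic k).biUnion fun n _ => hfin n k).subset ?_
      rintro y ⟨hy, hyk⟩
      obtain ⟨n, hyn, hyg⟩ := mem_iUnion.1 hy
      have hnk : n ≤ k := not_lt.1 fun hkn => hyg (mem_biUnion (mem_Iio.2 hkn) hyk)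
      exact mem_biUnion (mem_Iic.2 hnk) ⟨hyn, hyk⟩
    · rw [not_nonempty_iff_eq_empty] at hne
      exact finite_empty.subset (hne ▸ inter_subset_inter_left U hsub)
  · have hF : (D n ∩ ⋃ i ∈ Iio n, g i).Finite := by
      rw [inter_iUnion₂]
      exact (finite_Iio n).biUnion fun i _ => hfin n i
    rw [← derivedSet_sdiff_of_finite (D n) hF]
    exact derivedSet_mono _ _ (subset_iUnion (fun n => D n \ ⋃ i ∈ Iio n, g i) n)

/-- An open set meeting infinitely many members of `𝒰` contains an infinite member of
`I(S,𝒰)`. -/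
theorem exists_infinite_mem_idealI {X : Type*} [TopologicalSpace X] {S : Set X} (hS : Dense S)
    {𝒰 : Set (Set X)} (hdisj : 𝒰.PairwiseDisjoint id) (hopen : ∀ U ∈ 𝒰, IsOpen U)
    {W : Set X} (hW : IsOpen W) (hinf : {U ∈ 𝒰 | (W ∩ U).Nonempty}.Infinite) :
    ∃ D ∈ idealI S 𝒰, D.Infinite ∧ D ⊆ W := by
  let e := hinf.natEmbedding
  have hex : ∀ n, ∃ y, y ∈ W ∩ (e n : Set X) ∧ y ∈ S := fun n =>
    hS.inter_open_nonempty _ (hW.inter (hopen _ (e n).2.1)) (e n).2.2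
  choose s hs hsS using hex
  have heq : ∀ {n} {U}, U ∈ 𝒰 → s n ∈ U → (e n : Set X) = U := fun {n U} hU hn =>
    hdisj.elim_set (e n).2.1 hU (s n) (hs n).2 hn
  have hinj : ∀ {m n} {U}, U ∈ 𝒰 → s m ∈ U → s n ∈ U → m = n := fun hU hm hn =>
    e.injective (Subtype.ext ((heq hU hm).trans (heq hU hn).symm))
  refine ⟨range s, ⟨range_subset_iff.2 hsS, countable_range s, fun U hU => ?_⟩,
    infinite_range_of_injective fun m n hmn => ?_, range_subset_iff.2 fun n => (hs n).1⟩
  · refine Set.Subsingleton.finite ?_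
    rintro _ ⟨⟨m, rfl⟩, hm⟩ _ ⟨⟨n, rfl⟩, hn⟩
    rw [hinj hU hm hn]
  · exact hinj (e m).2.1 (hs m).2 (hmn ▸ (hs m).2)

theorem infinite_setOf_inter_nonempty_of_mem_closure {X : Type*} [TopologicalSpace X]
    {𝒰 : Set (Set X)} {x : X} (hx : x ∈ closure (⋃₀ 𝒰) \ (⋃ U ∈ 𝒰, closure U))
    {W : Set X} (hW : IsOpen W) (hxW : x ∈ W) :
    {U ∈ 𝒰 | (W ∩ U).Nonempty}.Infinite := by
  intro hfin
  have hsub : W ∩ ⋃₀ 𝒰 ⊆ ⋃₀ {U ∈ 𝒰 | (W ∩ U).Nonempty} := by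
    rintro y ⟨hyW, U, hU, hyU⟩
    exact ⟨U, ⟨hU, y, hyW, hyU⟩, hyU⟩
  have hmem := closure_mono hsub (hW.inter_closure ⟨hxW, hx.1⟩)
  rw [hfin.closure_sUnion] at hmem
  obtain ⟨U, hU, hxU⟩ := mem_iUnion₂.1 hmem
  exact hx.2 (mem_biUnion hU.1 hxU)

/-- In a regular countably compact space, every point of countable tightness in
`closure (⋃₀ 𝒰) \ ⋃ {closure U : U ∈ 𝒰}` is an accumulation point of some member of
`I(S,𝒰)`. -/
theorem stmt16 {X : Type*} [TopologicalSpace X] [T1Space X] [RegularSpace X]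
    (hcc : CountablyCompactSp X) (S : Set X) (hS : Dense S)
    (𝒰 : Set (Set X)) (hdisj : 𝒰.PairwiseDisjoint id)
    (hne : ∀ U ∈ 𝒰, U.Nonempty) (hopen : ∀ U ∈ 𝒰, IsOpen U)
    (x : X) (hx : x ∈ closure (⋃₀ 𝒰) \ (⋃ U ∈ 𝒰, closure U))
    (htight : CountableTightnessAt x) :
    ∃ D ∈ idealI S 𝒰, x ∈ derivedSet D := by
  have hcl : x ∈ closure (⋃ D ∈ idealI S 𝒰, derivedSet D) := by
    refine mem_closure_iff_nhds.2 fun N hN => ?_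
    obtain ⟨C, hC, hCclosed, hCN⟩ := exists_mem_nhds_isClosed_subset hN
    obtain ⟨D, hD, hDinf, hDC⟩ := exists_infinite_mem_idealI hS hdisj hopen isOpen_interior
      (infinite_setOf_inter_nonempty_of_mem_closure hx isOpen_interior
        (mem_interior_iff_mem_nhds.2 hC))
    obtain ⟨y, -, hy⟩ :=
      hcc.isCountablyCompact_univ.exists_accPt_of_infinite (subset_univ D) hDinf
    exact ⟨y, hCN (closure_minimal (hDC.trans interior_subset) hCclosed
      (derivedSet_subset_closure D hy)), mem_biUnion hD hy⟩
  obtain ⟨B, hBsub, hBcount, hxB⟩ := htight _ hcl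
  obtain ⟨y, rfl⟩ := hBcount.exists_eq_range (closure_nonempty_iff.1 ⟨x, hxB⟩)
  have hy : ∀ n, ∃ D ∈ idealI S 𝒰, y n ∈ derivedSet D := fun n => by
    simpa using hBsub (mem_range_self n)
  choose D hD hyD using hy
  obtain ⟨E, hE, hDE⟩ := exists_mem_idealI_derivedSet_subset hdisj hD
  exact ⟨E, hE, closure_minimal (range_subset_iff.2 fun n => hDE n (hyD n))
    (isClosed_derivedSet E) hxB⟩
end

section
/- Let X be a Hausdorff space that is not ω-bounded (some countable subset of X has non-compact closure) and let Y be a space containing an infinite discrete subspace. Then the product X × Y contains a countable discrete subspace whose closure is not compact (i.e., X × Y is not ωD-bounded). -/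
open Set Topology Filter

/-- If a Hausdorff space `X` is not ω-bounded and `Y` has an infinite discrete subspace,
then `X × Y` is not ωD-bounded. -/
theorem stmt17 {X Y : Type*} [TopologicalSpace X] [TopologicalSpace Y] [T2Space X]
    (hX : ∃ A : Set X, A.Countable ∧ ¬ IsCompact (closure A))
    (hY : ∃ B : Set Y, B.Infinite ∧ DiscreteTopology B) :
    ∃ D : Set (X × Y), D.Countable ∧ DiscreteTopology D ∧ ¬ IsCompact (closure D) := by
  obtain ⟨A, hA, hcl⟩ := hX
  obtain ⟨B, hB, _⟩ := hY
  have hne : A.Nonempty := by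
    rw [nonempty_iff_ne_empty]
    rintro rfl
    simp at hcl
  obtain ⟨a, rfl⟩ := hA.exists_eq_range hne
  have : Infinite B := hB.to_subtype
  let b : ℕ ↪ B := Infinite.natEmbedding B
  refine ⟨range fun n => (a n, (b n : Y)), countable_range _, ?_, fun hD => hcl ?_⟩
  · let f : (range fun n => (a n, (b n : Y))) → B :=
      fun p => ⟨p.1.2, by obtain ⟨_, n, rfl⟩ := p; exact (b n).2⟩
    have hf : Continuous f := by fun_prop
    refine DiscreteTopology.of_continuous_injective hf ?_
    rintro ⟨_, n, rfl⟩ ⟨_, m, rfl⟩ h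
    have hnm : n = m := b.injective (Subtype.ext (congrArg Subtype.val h))
    subst hnm
    rfl
  · have hK := hD.image continuous_fst
    refine hK.of_isClosed_subset isClosed_closure (closure_minimal ?_ hK.isClosed)
    rintro _ ⟨n, rfl⟩
    exact ⟨_, subset_closure (mem_range_self n), rfl⟩
end

section
/- Let X be a crowded T1 space (X has no isolated points) in which every countable nowhere dense subset has compact closure. Then every countable discrete subspace of X has compact closure in X. -/
open Set Topology Filter

/-- A discrete subspace of a crowded T₁ space is nowhere dense. -/
theorem isNowhereDense_of_discreteTopology {X : Type*} [TopologicalSpace X] [T1Space X]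
    (hcrowded : ∀ x : X, ¬ IsOpen ({x} : Set X)) (D : Set X) [DiscreteTopology D] :
    IsNowhereDense D := by
  rw [IsNowhereDense, eq_empty_iff_forall_notMem]
  intro x hx
  obtain ⟨d, hdU, hdD⟩ :=
    mem_closure_iff.1 (interior_subset hx) _ isOpen_interior hx
  obtain ⟨V, hV, hVd⟩ := isOpen_induced_iff.1 (isOpen_discrete ({⟨d, hdD⟩} : Set D))
  have hV_iff : ∀ e (he : e ∈ D), e ∈ V ↔ e = d := fun e he => by
    simpa using Set.ext_iff.1 hVd ⟨e, he⟩
  have hW : IsOpen (interior (closure D) ∩ V) := isOpen_interior.inter hV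
  apply hcrowded d
  convert hW using 1
  have hd : d ∈ interior (closure D) ∩ V := ⟨hdU, (hV_iff d hdD).2 rfl⟩
  refine (singleton_subset_iff.2 hd).antisymm fun y hy => ?_
  by_contra hyd
  obtain ⟨e, ⟨he, hed⟩, heD⟩ := mem_closure_iff.1 (interior_subset hy.1) _
    (hW.sdiff isClosed_singleton) ⟨hy, hyd⟩
  exact hed ((hV_iff e heD).1 he.2)

/-- A crowded (no isolated points) ωN-bounded space is ωD-bounded. -/
theorem stmt19 {X : Type*} [TopologicalSpace X] [T1Space X]
    (hcrowded : ∀ x : X, ¬ IsOpen ({x} : Set X))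
    (hωN : ∀ A : Set X, A.Countable → IsNowhereDense A → IsCompact (closure A)) :
    ∀ D : Set X, D.Countable → DiscreteTopology D → IsCompact (closure D) := by
  intro D hD _
  exact hωN D hD (isNowhereDense_of_discreteTopology hcrowded D)
end
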